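/- arXiv:2011.02583 — 10 statements merged into one kernel-verified Lean document; each statement's English description precedes it below -/
import Mathlib

section
/- Let K ⊊ V be a proper subset, α ∈ (0,1)^V a resistance vector, and P an irreducible row-stochastic matrix. Then the matrix I − (I − A_{−K})P is invertible, and every entry of M := [I − (I − A_{−K})P]^{−1} is strictly positive; in particular, M_{kk} > 1 for every k ∈ V. -/
open Matrix

lemma closed_pow {V : Type*} [Fintype V] [DecidableEq V] (P : Matrix V V ℝ) (S : V → Prop)
    (h : ∀ i j, S i → P i j ≠ 0 → S j) (t : ℕ) :
    ∀ i j, S i → (P ^ t) i j ≠ 0 → S j := by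
  induction t with
  | zero =>
    intro i j hi hij
    by_cases e : i = j
    · exact e ▸ hi
    · simp [Matrix.one_apply, e] at hij
  | succ t ih =>
    intro i j hi hij
    rw [pow_succ, Matrix.mul_apply] at hij
    obtain ⟨k, -, hk⟩ := Finset.exists_ne_zero_of_sum_ne_zero hij
    exact h k j (ih i k hi (left_ne_zero_of_mul hk)) (right_ne_zero_of_mul hk)

lemma min_principle {V : Type*} [Fintype V] [DecidableEq V] [Nonempty V]
    (P : Matrix V V ℝ)
    (hP0 : ∀ i j, 0 ≤ P i j) (hP1 : ∀ i, ∑ j, P i j = 1)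
    (hPirr : ∀ i j, ∃ t : ℕ, 1 ≤ t ∧ 0 < (P ^ t) i j)
    (b : V → ℝ) (hb0 : ∀ i, 0 < b i) (hb1 : ∀ i, b i ≤ 1) (i₀ : V) (hi₀ : b i₀ < 1)
    (x : V → ℝ) (hx : ∀ i, b i * ∑ j, P i j * x j ≤ x i) :
    x = 0 ∨ ∀ i, 0 < x i := by
  obtain ⟨m, hm⟩ := Finite.exists_min x
  by_cases hpos : 0 < x m
  · exact Or.inr fun i => hpos.trans_le (hm i)
  left
  push Not at hpos
  have key : ∀ i, x i = x m → ∑ j, P i j * (x j - x m) = 0 ∧ b i * x m = x m := by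
    intro i hi
    have h1 : ∑ j, P i j * (x j - x m) = ∑ j, P i j * x j - x m := by
      simp only [mul_sub, Finset.sum_sub_distrib]
      rw [← Finset.sum_mul, hP1, one_mul]
    have h2 : 0 ≤ ∑ j, P i j * (x j - x m) :=
      Finset.sum_nonneg fun j _ => mul_nonneg (hP0 i j) (sub_nonneg.2 (hm j))
    have h3 := hx i
    have h4 : x m ≤ b i * x m := by nlinarith [hb1 i]
    have h5 : 0 ≤ b i * ∑ j, P i j * (x j - x m) := mul_nonneg (hb0 i).le h2
    have h6 : b i * ∑ j, P i j * (x j - x m) = b i * ∑ j, P i j * x j - b i * x m := by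
      rw [h1]; ring
    have h7 : b i * ∑ j, P i j * (x j - x m) = 0 := by linarith
    exact ⟨(mul_eq_zero.1 h7).resolve_left (hb0 i).ne', by linarith⟩
  have hall : ∀ j, x j = x m := by
    intro j
    obtain ⟨t, -, ht⟩ := hPirr m j
    refine closed_pow P (fun i => x i = x m) ?_ t m j rfl ht.ne'
    intro i k hi hik
    have h := (Finset.sum_eq_zero_iff_of_nonneg (fun j _ =>
      mul_nonneg (hP0 i j) (sub_nonneg.2 (hm j)))).1 (key i hi).1 k (Finset.mem_univ k)
    exact sub_eq_zero.1 ((mul_eq_zero.1 h).resolve_left hik)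
  have h0 : x m = 0 := by
    have := (key i₀ (hall i₀)).2
    nlinarith
  funext j
  simp [hall j, h0]

/-- Lemma 1 (Inverse Arithmetic, existence/positivity part): for a proper subset `K ⊊ V`,
a resistance vector `α ∈ (0,1)^V` and an irreducible row-stochastic matrix `P`,
the matrix `I − (I − A_{−K})P` is invertible, every entry of its inverse `M` is
strictly positive, and the diagonal entries of `M` are strictly greater than `1`. -/
theorem stmt0 {V : Type*} [Fintype V] [DecidableEq V] [Nonempty V]
    (P : Matrix V V ℝ)
    (hP0 : ∀ i j, 0 ≤ P i j) (hP1 : ∀ i, ∑ j, P i j = 1)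
    (hPirr : ∀ i j, ∃ t : ℕ, 1 ≤ t ∧ 0 < (P ^ t) i j)
    (α : V → ℝ) (hα : ∀ i, α i ∈ Set.Ioo (0 : ℝ) 1)
    (K : Set V) [DecidablePred (· ∈ K)] (hK : K ≠ Set.univ)
    (M : Matrix V V ℝ)
    (hM : M = (1 - (1 - diagonal (fun i => if i ∈ K then 0 else α i)) * P)⁻¹) :
    IsUnit (1 - (1 - diagonal (fun i => if i ∈ K then 0 else α i)) * P) ∧
    (∀ k j, 0 < M k j) ∧ (∀ k, 1 < M k k) := by
  set b : V → ℝ := fun i => 1 - (if i ∈ K then 0 else α i) with hb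
  set N : Matrix V V ℝ := 1 - (1 - diagonal (fun i => if i ∈ K then 0 else α i)) * P with hN
  have hD : (1 - diagonal (fun i => if i ∈ K then 0 else α i) : Matrix V V ℝ) = diagonal b := by
    rw [← diagonal_one, diagonal_sub]
  have hb0 : ∀ i, 0 < b i := by
    intro i
    have := (hα i).2
    simp only [hb]; split_ifs <;> linarith
  have hb1 : ∀ i, b i ≤ 1 := by
    intro i
    have := (hα i).1
    simp only [hb]; split_ifs <;> linarith
  obtain ⟨i₀, hi₀⟩ := (Set.ne_univ_iff_exists_notMem K).1 hK
  have hbi₀ : b i₀ < 1 := by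
    have := (hα i₀).1
    simp only [hb, if_neg hi₀]; linarith
  have hmv : ∀ x : V → ℝ, ∀ i, (N *ᵥ x) i = x i - b i * ∑ j, P i j * x j := by
    intro x i
    rw [hN, hD, sub_mulVec, one_mulVec, ← mulVec_mulVec, Pi.sub_apply, mulVec_diagonal]
    rfl
  have hmin : ∀ x : V → ℝ, (∀ i, 0 ≤ (N *ᵥ x) i) → x = 0 ∨ ∀ i, 0 < x i := by
    intro x hx
    refine min_principle P hP0 hP1 hPirr b hb0 hb1 i₀ hbi₀ x fun i => ?_
    have := hx i
    rw [hmv] at this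
    linarith
  have hU : IsUnit N := by
    rw [← Matrix.mulVec_injective_iff_isUnit]
    intro x y hxy
    have hxy' : N *ᵥ x = N *ᵥ y := hxy
    have e1 : N *ᵥ (x - y) = 0 := by rw [mulVec_sub, hxy', sub_self]
    have e2 : N *ᵥ (y - x) = 0 := by rw [mulVec_sub, hxy', sub_self]
    rcases hmin (x - y) (by simp [e1]) with h | h
    · exact sub_eq_zero.1 h
    rcases hmin (y - x) (by simp [e2]) with h' | h'
    · exact (sub_eq_zero.1 h').symm
    have a1 := h i₀
    have a2 := h' i₀
    simp only [Pi.sub_apply] at a1 a2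
    linarith
  have hNM : N * M = 1 := by
    rw [hM]
    exact Matrix.mul_nonsing_inv N ((Matrix.isUnit_iff_isUnit_det N).1 hU)
  have hcol : ∀ j i, (N *ᵥ (fun k => M k j)) i = (1 : Matrix V V ℝ) i j := by
    intro j i
    rw [← hNM]
    rfl
  have hpos : ∀ k j, 0 < M k j := by
    intro k j
    rcases hmin (fun k => M k j) (fun i => by
      rw [hcol, Matrix.one_apply]; split_ifs <;> norm_num) with h | h
    · have := hcol j j
      rw [h] at this
      simp at this
    · exact h k
  refine ⟨hU, hpos, fun k => ?_⟩
  have h := hcol k k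
  rw [hmv, Matrix.one_apply_eq] at h
  have hs : 0 < ∑ j, P k j * M j k := by
    have hne : ∑ j, P k j ≠ 0 := by rw [hP1]; exact one_ne_zero
    obtain ⟨j, -, hj⟩ := Finset.exists_ne_zero_of_sum_ne_zero hne
    exact Finset.sum_pos' (fun j _ => mul_nonneg (hP0 k j) (hpos j k).le)
      ⟨j, Finset.mem_univ j, mul_pos (lt_of_le_of_ne (hP0 k j) hj.symm) (hpos j k)⟩
  have := mul_pos (hb0 k) hs
  linarith
end

section
/- Let K ⊊ V be a proper subset, α ∈ (0,1)^V, P an irreducible row-stochastic matrix, and M = [I − (I − A_{−K})P]^{−1}. For each k ∈ V set a_k = 0 if k ∈ K and a_k = α_k otherwise. Then (PM)_{kk} = (M_{kk} − 1)/(1 − a_k) > 0, and for each j ≠ k, (PM)_{kj} = M_{kj}/(1 − a_k) > 0. -/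
open Matrix

theorem closed_univ {V : Type*} [Fintype V] [DecidableEq V] (P : Matrix V V ℝ)
    (hPirr : ∀ i j, ∃ t : ℕ, 1 ≤ t ∧ 0 < (P ^ t) i j) (S : V → Prop)
    (hS : ∀ i j, S i → ¬ S j → P i j = 0) (i : V) (hi : S i) (j : V) : S j := by
  have key : ∀ t : ℕ, ∀ j, ¬ S j → (P ^ t) i j = 0 := by
    intro t
    induction t with
    | zero =>
      intro j hj
      have : i ≠ j := by rintro rfl; exact hj hi
      simp [this]
    | succ t ih =>
      intro j hj
      rw [pow_succ, Matrix.mul_apply]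
      apply Finset.sum_eq_zero
      intro l _
      by_cases hl : S l
      · rw [hS l j hl hj, mul_zero]
      · rw [ih l hl, zero_mul]
  by_contra hj
  obtain ⟨t, _, ht⟩ := hPirr i j
  rw [key t j hj] at ht
  exact lt_irrefl _ ht

theorem min_nonneg {V : Type*} [Fintype V] [DecidableEq V] [Nonempty V] (P : Matrix V V ℝ)
    (hP0 : ∀ i j, 0 ≤ P i j) (hP1 : ∀ i, ∑ j, P i j = 1)
    (hPirr : ∀ i j, ∃ t : ℕ, 1 ≤ t ∧ 0 < (P ^ t) i j)
    (b : V → ℝ) (hb0 : ∀ i, 0 < b i) (hb1 : ∀ i, b i ≤ 1) (hb : ∃ i, b i < 1)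
    (x : V → ℝ) (hx : ∀ i, b i * ∑ j, P i j * x j ≤ x i) (i : V) : 0 ≤ x i := by
  obtain ⟨m, hm⟩ := Finite.exists_min x
  by_contra hi
  have hneg : x m < 0 := lt_of_le_of_lt (hm i) (not_le.mp hi)
  have h1 : ∀ i, ∑ j, P i j * x j = ∑ j, P i j * (x j - x m) + x m := by
    intro i
    simp only [mul_sub, Finset.sum_sub_distrib, ← Finset.sum_mul, hP1]
    ring
  have h2 : ∀ i j, 0 ≤ P i j * (x j - x m) := fun i j =>
    mul_nonneg (hP0 i j) (sub_nonneg.mpr (hm j))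
  have h3 : ∀ i, 0 ≤ ∑ j, P i j * (x j - x m) := fun i => Finset.sum_nonneg fun j _ => h2 i j
  have hS : ∀ j, x j = x m := by
    refine closed_univ P hPirr (fun j => x j = x m) ?_ m rfl
    intro i j hi hj
    have h4 := hx i
    rw [h1, hi] at h4
    have h5 : ∑ j, P i j * (x j - x m) = 0 := by
      have := hb0 i
      have := hb1 i
      have := h3 i
      have h6 : b i * ∑ j, P i j * (x j - x m) ≤ 0 := by nlinarith
      exact le_antisymm (by by_contra hc; push Not at hc; nlinarith [mul_pos (hb0 i) hc]) this
    have h6 := (Finset.sum_eq_zero_iff_of_nonneg (fun j _ => h2 i j)).mp h5 j (Finset.mem_univ j)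
    exact (mul_eq_zero.mp h6).resolve_right (sub_ne_zero.mpr hj)
  obtain ⟨k, hk⟩ := hb
  have h4 := hx k
  simp only [hS, ← Finset.sum_mul, hP1] at h4
  nlinarith

theorem all_pos {V : Type*} [Fintype V] [DecidableEq V] (P : Matrix V V ℝ)
    (hP0 : ∀ i j, 0 ≤ P i j)
    (hPirr : ∀ i j, ∃ t : ℕ, 1 ≤ t ∧ 0 < (P ^ t) i j)
    (b : V → ℝ) (hb0 : ∀ i, 0 < b i)
    (x : V → ℝ) (hx : ∀ i, b i * ∑ j, P i j * x j ≤ x i) (hx0 : ∀ i, 0 ≤ x i)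
    (k : V) (hk : 0 < x k) (i : V) : 0 < x i := by
  refine lt_of_le_of_ne (hx0 i) fun h0 => hk.ne' ?_
  refine closed_univ P hPirr (fun j => x j = 0) ?_ i h0.symm k
  intro i j hi hj
  have h2 : ∀ j, 0 ≤ P i j * x j := fun j => mul_nonneg (hP0 i j) (hx0 j)
  have h4 := hx i
  rw [hi] at h4
  have h5 : ∑ j, P i j * x j = 0 :=
    le_antisymm (nonpos_of_mul_nonpos_right h4 (hb0 i)) (Finset.sum_nonneg fun j _ => h2 j)
  have h6 := (Finset.sum_eq_zero_iff_of_nonneg (fun j _ => h2 j)).mp h5 j (Finset.mem_univ j)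
  exact (mul_eq_zero.mp h6).resolve_right hj

/-- Lemma 1 (Inverse Arithmetic, entry formulas): with `M = [I − (I − A_{−K})P]⁻¹` and
`a_k = 0` for `k ∈ K`, `a_k = α_k` otherwise, one has
`(PM)_{kk} = (M_{kk} − 1)/(1 − a_k) > 0` and `(PM)_{kj} = M_{kj}/(1 − a_k) > 0` for `j ≠ k`. -/
theorem stmt1 {V : Type*} [Fintype V] [DecidableEq V] [Nonempty V]
    (P : Matrix V V ℝ)
    (hP0 : ∀ i j, 0 ≤ P i j) (hP1 : ∀ i, ∑ j, P i j = 1)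
    (hPirr : ∀ i j, ∃ t : ℕ, 1 ≤ t ∧ 0 < (P ^ t) i j)
    (α : V → ℝ) (hα : ∀ i, α i ∈ Set.Ioo (0 : ℝ) 1)
    (K : Set V) [DecidablePred (· ∈ K)] (hK : K ≠ Set.univ)
    (M : Matrix V V ℝ)
    (hM : M = (1 - (1 - diagonal (fun i => if i ∈ K then 0 else α i)) * P)⁻¹)
    (a : V → ℝ) (ha : ∀ k, a k = if k ∈ K then 0 else α k) :
    ∀ k : V,
      ((P * M) k k = (M k k - 1) / (1 - a k) ∧ 0 < (P * M) k k) ∧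
      (∀ j : V, j ≠ k → (P * M) k j = M k j / (1 - a k) ∧ 0 < (P * M) k j) := by
  have ha' : (fun i => if i ∈ K then 0 else α i) = a := (funext ha).symm
  rw [ha'] at hM
  have hb0 : ∀ i, 0 < 1 - a i := by
    intro i
    rw [ha]
    split_ifs
    · norm_num
    · linarith [(hα i).2]
  have hb1 : ∀ i, 1 - a i ≤ 1 := by
    intro i
    rw [ha]
    split_ifs
    · norm_num
    · linarith [(hα i).1]
  have hb : ∃ i, 1 - a i < 1 := by
    obtain ⟨i, hi⟩ := (Set.ne_univ_iff_exists_notMem K).mp hK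
    refine ⟨i, ?_⟩
    rw [ha, if_neg hi]
    linarith [(hα i).1]
  have hB : (1 - diagonal a : Matrix V V ℝ) = diagonal (fun i => 1 - a i) := by
    rw [← diagonal_one, diagonal_sub]
  rw [hB] at hM
  have hdet : (1 - diagonal (fun i => 1 - a i) * P).det ≠ 0 := by
    intro h
    obtain ⟨v, hv, hv0⟩ := Matrix.exists_mulVec_eq_zero_iff.mpr h
    have e : ∀ i, v i = (1 - a i) * ∑ j, P i j * v j := by
      intro i
      have := congrFun hv0 i
      rw [sub_mulVec, one_mulVec, ← mulVec_mulVec, Pi.sub_apply, mulVec_diagonal] at this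
      simpa [mulVec, dotProduct] using sub_eq_zero.mp this
    apply hv
    funext i
    have p1 := min_nonneg P hP0 hP1 hPirr _ hb0 hb1 hb v (fun i => (e i).ge) i
    have p2 := min_nonneg P hP0 hP1 hPirr _ hb0 hb1 hb (fun i => - v i)
      (fun i => by
        simp only [mul_neg, Finset.sum_neg_distrib]
        exact neg_le_neg (e i).le) i
    simp only [Pi.zero_apply]
    linarith
  have hMeq : M = 1 + diagonal (fun i => 1 - a i) * (P * M) := by
    have := Matrix.mul_nonsing_inv _ (isUnit_iff_ne_zero.mpr hdet)
    rw [← hM, sub_mul, one_mul, Matrix.mul_assoc] at this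
    exact sub_eq_iff_eq_add.mp this
  have hent : ∀ i j, M i j = (1 : Matrix V V ℝ) i j + (1 - a i) * (P * M) i j := by
    intro i j
    have := congrFun (congrFun hMeq i) j
    rwa [Matrix.add_apply, diagonal_mul] at this
  have hx : ∀ j i, (1 - a i) * ∑ l, P i l * M l j ≤ M i j := by
    intro j i
    have h1 := hent i j
    rw [Matrix.mul_apply] at h1
    have : 0 ≤ (1 : Matrix V V ℝ) i j := by
      rw [Matrix.one_apply]; split_ifs <;> norm_num
    linarith
  have hnn : ∀ j i, 0 ≤ M i j := fun j i =>
    min_nonneg P hP0 hP1 hPirr _ hb0 hb1 hb (fun l => M l j) (hx j) i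
  have hPMnn : ∀ i j, 0 ≤ (P * M) i j := fun i j => by
    rw [Matrix.mul_apply]
    exact Finset.sum_nonneg fun l _ => mul_nonneg (hP0 i l) (hnn j l)
  have hpos : ∀ j i, 0 < M i j := by
    intro j
    refine all_pos P hP0 hPirr _ hb0 (fun l => M l j) (hx j) (hnn j) j ?_
    have := hent j j
    rw [Matrix.one_apply_eq] at this
    have := mul_nonneg (hb0 j).le (hPMnn j j)
    linarith
  have hPM : ∀ i j, 0 < (P * M) i j := by
    intro i j
    rw [Matrix.mul_apply]
    have hne : ∃ l ∈ Finset.univ, P i l ≠ 0 := by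
      apply Finset.exists_ne_zero_of_sum_ne_zero
      rw [hP1]; norm_num
    obtain ⟨l, hl, hl0⟩ := hne
    exact Finset.sum_pos' (fun l _ => mul_nonneg (hP0 i l) (hnn j l))
      ⟨l, hl, mul_pos (lt_of_le_of_ne (hP0 i l) hl0.symm) (hpos j l)⟩
  intro k
  refine ⟨⟨?_, hPM k k⟩, fun j hj => ⟨?_, hPM k j⟩⟩
  · rw [eq_div_iff (hb0 k).ne', hent k k, Matrix.one_apply_eq]
    ring
  · rw [eq_div_iff (hb0 k).ne', hent k j, Matrix.one_apply_ne hj.symm]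
    ring
end

section
/- Let K ⊊ V be a proper subset, α ∈ (0,1)^V, and P an irreducible row-stochastic matrix. Then the Neumann series I + Σ_{j=1}^{∞} [(I − A_{−K})P]^j converges and equals [I − (I − A_{−K})P]^{−1}; equivalently, the powers [(I − A_{−K})P]^j converge to the zero matrix as j → ∞. -/
open Matrix Filter

/-- The Neumann series `Σ_{j=0}^∞ [(I − A_{−K})P]^j` converges (as a sum) to
`[I − (I − A_{−K})P]⁻¹`, and the powers `[(I − A_{−K})P]^j` tend to the zero matrix. -/
theorem stmt2 {V : Type*} [Fintype V] [DecidableEq V] [Nonempty V]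
    (P : Matrix V V ℝ)
    (hP0 : ∀ i j, 0 ≤ P i j) (hP1 : ∀ i, ∑ j, P i j = 1)
    (hPirr : ∀ i j, ∃ t : ℕ, 1 ≤ t ∧ 0 < (P ^ t) i j)
    (α : V → ℝ) (hα : ∀ i, α i ∈ Set.Ioo (0 : ℝ) 1)
    (K : Set V) [DecidablePred (· ∈ K)] (hK : K ≠ Set.univ)
    (Q : Matrix V V ℝ)
    (hQ : Q = (1 - diagonal (fun i => if i ∈ K then 0 else α i)) * P) :
    Tendsto (fun j : ℕ => Q ^ j) atTop (nhds 0) ∧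
    HasSum (fun j : ℕ => Q ^ j) (1 - Q)⁻¹ := by
  classical
  obtain ⟨k, hk⟩ : ∃ k, k ∉ K := by
    by_contra! h
    exact hK (Set.eq_univ_of_forall h)
  have hQe : ∀ i j, Q i j = (1 - if i ∈ K then 0 else α i) * P i j := by
    intro i j
    rw [hQ, sub_mul, one_mul, Matrix.sub_apply, Matrix.diagonal_mul]
    ring
  have hQ0 : ∀ i j, 0 ≤ Q i j := by
    intro i j
    rw [hQe]
    refine mul_nonneg ?_ (hP0 i j)
    have := hα i
    split_ifs
    · norm_num
    · linarith [this.2]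
  have hQP : ∀ i j, Q i j ≤ P i j := by
    intro i j
    rw [hQe]
    refine mul_le_of_le_one_left (hP0 i j) ?_
    have := hα i
    split_ifs
    · norm_num
    · linarith [this.1]
  have hQn0 : ∀ n i j, 0 ≤ (Q ^ n) i j := by
    intro n
    induction n with
    | zero =>
      intro i j
      rw [pow_zero, Matrix.one_apply]
      split_ifs <;> norm_num
    | succ n ih =>
      intro i j
      rw [pow_succ, Matrix.mul_apply]
      exact Finset.sum_nonneg fun l _ => mul_nonneg (ih i l) (hQ0 l j)
  have hPn0 : ∀ n i j, 0 ≤ (P ^ n) i j := by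
    intro n
    induction n with
    | zero =>
      intro i j
      rw [pow_zero, Matrix.one_apply]
      split_ifs <;> norm_num
    | succ n ih =>
      intro i j
      rw [pow_succ, Matrix.mul_apply]
      exact Finset.sum_nonneg fun l _ => mul_nonneg (ih i l) (hP0 l j)
  -- row sums of the powers
  obtain ⟨r, hr⟩ : ∃ r : ℕ → V → ℝ, ∀ n i, r n i = ∑ j, (Q ^ n) i j := ⟨_, fun _ _ => rfl⟩
  have hradd : ∀ m n i, r (m + n) i = ∑ j, (Q ^ m) i j * r n j := by
    intro m n i
    simp only [hr, pow_add, Matrix.mul_apply, Finset.mul_sum]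
    exact Finset.sum_comm
  have hr0 : ∀ n i, 0 ≤ r n i := fun n i => by
    rw [hr]; exact Finset.sum_nonneg fun j _ => hQn0 n i j
  have hrz : ∀ i, r 0 i = 1 := fun i => by
    simp [hr, Matrix.one_apply]
  have hrs : ∀ n i, r (n + 1) i = ∑ j, Q i j * r n j := fun n i => by
    rw [add_comm, hradd, pow_one]
  have hr1 : ∀ n i, r n i ≤ 1 := by
    intro n
    induction n with
    | zero => intro i; exact (hrz i).le
    | succ n ih =>
      intro i
      rw [hrs, ← hP1 i]
      exact Finset.sum_le_sum fun j _ =>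
        (mul_le_of_le_one_right (hQ0 i j) (ih j)).trans (hQP i j)
  have hanti : ∀ m n i, r (m + n) i ≤ r m i := by
    intro m n i
    rw [hradd, hr m]
    exact Finset.sum_le_sum fun j _ => mul_le_of_le_one_right (hQn0 m i j) (hr1 n j)
  have hlt : ∀ t i, 0 < (P ^ t) i k → r (t + 1) i < 1 := by
    intro t
    induction t with
    | zero =>
      intro i hi
      have hik : i = k := by
        by_contra h
        rw [pow_zero, Matrix.one_apply_ne h] at hi
        exact lt_irrefl _ hi
      subst hik
      rw [hrs]
      simp only [hrz, mul_one, hQe, if_neg hk]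
      rw [← Finset.mul_sum, hP1]
      linarith [(hα i).1]
    | succ t ih =>
      intro i hi
      rw [pow_succ', Matrix.mul_apply] at hi
      obtain ⟨j, hj⟩ : ∃ j, 0 < P i j * (P ^ t) j k := by
        by_contra! h
        exact absurd hi (not_lt.2 (Finset.sum_nonpos fun j _ => h j))
      have h1 : 0 < P i j := pos_of_mul_pos_left hj (hPn0 t j k)
      have h2 : 0 < (P ^ t) j k := pos_of_mul_pos_right hj (hP0 i j)
      rw [hrs, ← hP1 i]
      refine Finset.sum_lt_sum (fun l _ =>
        (mul_le_of_le_one_right (hQ0 i l) (hr1 _ l)).trans (hQP i l)) ⟨j, Finset.mem_univ _, ?_⟩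
      calc Q i j * r (t + 1) j ≤ P i j * r (t + 1) j :=
            mul_le_mul_of_nonneg_right (hQP i j) (hr0 _ _)
        _ < P i j := mul_lt_of_lt_one_right h1 (ih j h2)
  obtain ⟨N, hN⟩ : ∃ N, ∀ i, r N i < 1 := by
    choose t ht using fun i => hPirr i k
    refine ⟨∑ i, (t i + 1), fun i => ?_⟩
    have hle : t i + 1 ≤ ∑ i, (t i + 1) :=
      Finset.single_le_sum (f := fun i => t i + 1) (fun _ _ => Nat.zero_le _) (Finset.mem_univ i)
    obtain ⟨d, hd⟩ := Nat.exists_eq_add_of_le hle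
    rw [hd]
    exact (hanti _ _ _).trans_lt (hlt _ _ (ht i).2)
  obtain ⟨c, hc1, hc⟩ : ∃ c, c < 1 ∧ ∀ i, r N i ≤ c := by
    obtain ⟨i, hi⟩ := Finite.exists_max (r N)
    exact ⟨r N i, hN i, hi⟩
  have hsumr : ∀ i, Summable fun n => r n i := by
    intro i
    refine summable_of_sum_range_le (c := N / (1 - c)) (fun n => hr0 n i) fun m => ?_
    rw [le_div_iff₀ (by linarith)]
    have h1 : ∑ n ∈ Finset.range m, r n i ≤ ∑ n ∈ Finset.range (N + m), r n i :=
      Finset.sum_le_sum_of_subset_of_nonneg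
        (Finset.range_subset_range.2 (by omega)) fun n _ _ => hr0 n i
    rw [Finset.sum_range_add] at h1
    have h2 : ∑ n ∈ Finset.range N, r n i ≤ N := by
      simpa using Finset.sum_le_sum (s := Finset.range N) fun n _ => hr1 n i
    have h3 : ∑ n ∈ Finset.range m, r (N + n) i ≤ c * ∑ n ∈ Finset.range m, r n i := by
      rw [Finset.mul_sum]
      refine Finset.sum_le_sum fun n _ => ?_
      rw [add_comm, hradd, hr n, Finset.mul_sum]
      refine Finset.sum_le_sum fun j _ => ?_
      rw [mul_comm c]
      exact mul_le_mul_of_nonneg_left (hc j) (hQn0 n i j)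
    linarith
  have hsum : Summable fun n : ℕ => Q ^ n := by
    refine Pi.summable.2 fun i => Pi.summable.2 fun j => ?_
    refine Summable.of_nonneg_of_le (fun n => hQn0 n i j) (fun n => ?_) (hsumr i)
    rw [hr]
    exact Finset.single_le_sum (f := fun j => (Q ^ n) i j) (fun l _ => hQn0 n i l)
      (Finset.mem_univ j)
  refine ⟨hsum.tendsto_atTop_zero, ?_⟩
  rw [Matrix.inv_eq_left_inv hsum.tsum_pow_mul_one_sub]
  exact hsum.hasSum
end

section
/- Let α ∈ (0,1)^V, let P be an irreducible row-stochastic matrix, s ∈ [0,1]^V, M(α) = [I − (I − A)P]^{−1}, and z(α) = M(α) A s. Viewing z as a function of the coordinate α_i with all other coordinates fixed, for every i, k ∈ V the partial derivative exists and satisfies ∂z_k(α)/∂α_i = M(α)_{ki} · (s_i − z_i(α)) / (1 − α_i). -/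
open Matrix

theorem aux_det {V : Type*} [Fintype V] [DecidableEq V] (P : Matrix V V ℝ)
    (hP0 : ∀ i j, 0 ≤ P i j) (hP1 : ∀ i, ∑ j, P i j = 1)
    (a : V → ℝ) (ha : ∀ i, a i ∈ Set.Ioo (0 : ℝ) 1) :
    IsUnit (1 - (1 - diagonal a) * P).det := by
  rw [isUnit_iff_ne_zero]
  have entry : ∀ k j, (1 - (1 - diagonal a) * P) k j
      = (1 : Matrix V V ℝ) k j - (1 - a k) * P k j := by
    intro k j
    rw [← diagonal_one, diagonal_sub, Matrix.sub_apply, diagonal_mul]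
  apply det_ne_zero_of_sum_row_lt_diag
  intro k
  have hk := ha k
  have h1 : ∑ j ∈ Finset.univ.erase k, P k j = 1 - P k k := by
    rw [← hP1 k, ← Finset.sum_erase_add _ _ (Finset.mem_univ k)]; ring
  have h0 : 0 ≤ 1 - P k k := by
    rw [← h1]; exact Finset.sum_nonneg fun j _ => hP0 k j
  have h2 : ∑ j ∈ Finset.univ.erase k, ‖(1 - (1 - diagonal a) * P) k j‖
      = (1 - a k) * (1 - P k k) := by
    rw [← h1, Finset.mul_sum]
    refine Finset.sum_congr rfl fun j hj => ?_
    rw [entry, one_apply_ne (Finset.ne_of_mem_erase hj).symm, zero_sub, norm_neg,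
      Real.norm_of_nonneg (mul_nonneg (by linarith [hk.2]) (hP0 k j))]
  rw [h2, entry, one_apply_eq]
  refine lt_of_lt_of_le ?_ (le_abs_self _)
  nlinarith [hk.1, hk.2]

theorem aux_fix {V : Type*} [Fintype V] [DecidableEq V] (P : Matrix V V ℝ)
    (hP0 : ∀ i j, 0 ≤ P i j) (hP1 : ∀ i, ∑ j, P i j = 1) (s : V → ℝ)
    (a : V → ℝ) (ha : ∀ i, a i ∈ Set.Ioo (0 : ℝ) 1) (z : V → ℝ)
    (hz : z = (1 - (1 - diagonal a) * P)⁻¹ *ᵥ (diagonal a *ᵥ s)) (k : V) :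
    z k = a k * s k + (1 - a k) * (P *ᵥ z) k := by
  have h : (1 - (1 - diagonal a) * P) *ᵥ z = diagonal a *ᵥ s := by
    rw [hz, mulVec_mulVec, mul_nonsing_inv _ (aux_det P hP0 hP1 a ha), one_mulVec]
  have h' := congrFun h k
  rw [← diagonal_one, diagonal_sub, sub_mulVec, ← mulVec_mulVec, diagonal_one, one_mulVec,
    Pi.sub_apply, mulVec_diagonal, mulVec_diagonal] at h'
  linarith

/-- The partial derivative of the equilibrium vector with respect to a single resistance
coordinate: `∂z_k(α)/∂α_i = M(α)_{ki} (s_i − z_i(α)) / (1 − α_i)`,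
where `M(α) = [I − (I − A)P]⁻¹` and `z(α) = M(α) A s`. -/
theorem stmt4 {V : Type*} [Fintype V] [DecidableEq V] [Nonempty V]
    (P : Matrix V V ℝ)
    (hP0 : ∀ i j, 0 ≤ P i j) (hP1 : ∀ i, ∑ j, P i j = 1)
    (hPirr : ∀ i j, ∃ t : ℕ, 1 ≤ t ∧ 0 < (P ^ t) i j)
    (s : V → ℝ) (hs : ∀ i, s i ∈ Set.Icc (0 : ℝ) 1)
    (α : V → ℝ) (hα : ∀ i, α i ∈ Set.Ioo (0 : ℝ) 1)
    (M : (V → ℝ) → Matrix V V ℝ)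
    (hM : ∀ a : V → ℝ, M a = (1 - (1 - diagonal a) * P)⁻¹)
    (z : (V → ℝ) → V → ℝ)
    (hz : ∀ a : V → ℝ, z a = M a *ᵥ (diagonal a *ᵥ s)) :
    ∀ i k : V,
      HasDerivAt (fun x : ℝ => z (Function.update α i x) k)
        (M α k i * (s i - z α i) / (1 - α i)) (α i) := by
  intro i k
  have fix : ∀ a : V → ℝ, (∀ j, a j ∈ Set.Ioo (0 : ℝ) 1) → ∀ j,
      z a j = a j * s j + (1 - a j) * (P *ᵥ z a) j := fun a ha j =>
    aux_fix P hP0 hP1 s a ha (z a) (by rw [hz, hM]) j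
  have key : ∀ x ∈ Set.Ioo (0 : ℝ) 1, ∀ j, z (Function.update α i x) j
      = z α j + (x - α i) * (s i - (P *ᵥ z (Function.update α i x)) i) * M α j i := by
    intro x hx
    have hax : ∀ j, Function.update α i x j ∈ Set.Ioo (0 : ℝ) 1 := by
      intro j
      by_cases h : j = i
      · subst h; simpa using hx
      · simpa [h] using hα j
    set y := z (Function.update α i x) with hy
    have e : (1 - (1 - diagonal α) * P) *ᵥ y
        = diagonal α *ᵥ s + Pi.single i ((x - α i) * (s i - (P *ᵥ y) i)) := by
      ext j
      have f := fix _ hax j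
      rw [← hy] at f
      rw [← diagonal_one, diagonal_sub, sub_mulVec, ← mulVec_mulVec, diagonal_one, one_mulVec,
        Pi.sub_apply, mulVec_diagonal, Pi.add_apply, mulVec_diagonal]
      by_cases h : j = i
      · subst h
        rw [Function.update_self] at f
        rw [Pi.single_eq_same, f]; ring
      · rw [Function.update_of_ne h] at f
        rw [Pi.single_eq_of_ne h, f]; ring
    have e2 : y = z α + M α *ᵥ Pi.single i ((x - α i) * (s i - (P *ᵥ y) i)) := by
      rw [hz α, ← mulVec_add, ← e, hM, mulVec_mulVec,
        nonsing_inv_mul _ (aux_det P hP0 hP1 α hα), one_mulVec]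
    intro j
    have e3 := congrFun e2 j
    rw [Pi.add_apply, mulVec_single] at e3
    simp only [Pi.smul_apply, MulOpposite.smul_eq_mul_unop, MulOpposite.unop_op, col_apply] at e3
    linarith
  set c := (P * M α) i i with hc
  set w := (P *ᵥ z α) i with hw
  have key2 : ∀ x ∈ Set.Ioo (0 : ℝ) 1,
      (s i - (P *ᵥ z (Function.update α i x)) i) * (1 + (x - α i) * c) = s i - w := by
    intro x hx
    have h : (P *ᵥ z (Function.update α i x)) i
        = w + (x - α i) * (s i - (P *ᵥ z (Function.update α i x)) i) * c := by
      generalize hr : (x - α i) * (s i - (P *ᵥ z (Function.update α i x)) i) = r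
      have kx := key x hx
      rw [hr] at kx
      rw [hw, hc, mul_apply]
      simp only [mulVec, dotProduct]
      rw [Finset.mul_sum, ← Finset.sum_add_distrib]
      refine Finset.sum_congr rfl fun j _ => ?_
      rw [kx j]; ring
    linarith
  have hne : ∀ᶠ x in nhds (α i), 1 + (x - α i) * c ≠ 0 := by
    have : ContinuousAt (fun x : ℝ => 1 + (x - α i) * c) (α i) := by fun_prop
    exact this.eventually_ne (by simp)
  have hev : (fun x : ℝ => z (Function.update α i x) k) =ᶠ[nhds (α i)]
      fun x => z α k + (x - α i) * ((s i - w) * M α k i) / (1 + (x - α i) * c) := by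
    filter_upwards [hne, isOpen_Ioo.mem_nhds (hα i)] with x h1 h2
    rw [key x h2 k, ← key2 x h2]
    field_simp
  refine HasDerivAt.congr_of_eventuallyEq ?_ hev
  have hd : HasDerivAt (fun x : ℝ => x - α i) 1 (α i) := (hasDerivAt_id _).sub_const _
  have hD := ((hd.mul_const ((s i - w) * M α k i)).div ((hd.mul_const c).const_add 1)
    (by simp)).const_add (z α k)
  refine HasDerivAt.congr_deriv hD ?_
  have f := fix α hα i
  rw [← hw] at f
  have h1 : 1 - α i ≠ 0 := by linarith [(hα i).2]
  rw [f, eq_div_iff h1]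
  simp only [sub_self, zero_mul, add_zero, one_mul, one_pow, div_one, mul_one, sub_zero]
  ring
end

section
/- Let α ∈ (0,1)^V, let P be an irreducible row-stochastic matrix, s ∈ [0,1]^V, and z(α) = [I − (I − A)P]^{−1} A s. Then for every i, k ∈ V, the partial derivative ∂z_k(α)/∂α_i and the quantity s_i − z_i(α) have exactly the same sign in {−, 0, +} (i.e., both are positive, both are zero, or both are negative). Consequently, ∂f(α)/∂α_i = Σ_{k∈V} ∂z_k(α)/∂α_i also has the same sign as s_i − z_i(α), where f(α) = 1ᵀ z(α). -/
open Matrix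

lemma aux_mulVec {V : Type*} [Fintype V] [DecidableEq V] (P : Matrix V V ℝ) (a v : V → ℝ) (k : V) :
    ((1 - (1 - diagonal a) * P) *ᵥ v) k = v k - (1 - a k) * (P *ᵥ v) k := by
  rw [sub_mulVec, ← mulVec_mulVec, sub_mulVec, one_mulVec, one_mulVec]
  simp only [Pi.sub_apply, mulVec_diagonal]
  ring

lemma aux_nonneg {V : Type*} [Fintype V] [DecidableEq V] [Nonempty V] (P : Matrix V V ℝ)
    (hP0 : ∀ i j, 0 ≤ P i j) (hP1 : ∀ i, ∑ j, P i j = 1)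
    (a : V → ℝ) (ha : ∀ i, a i ∈ Set.Ioo (0 : ℝ) 1) (v : V → ℝ)
    (hv : ∀ k, 0 ≤ v k - (1 - a k) * (P *ᵥ v) k) (k : V) : 0 ≤ v k := by
  obtain ⟨m, hm⟩ := Finite.exists_min v
  have h1 : v m ≤ (P *ᵥ v) m := by
    calc v m = ∑ j, P m j * v m := by rw [← Finset.sum_mul, hP1, one_mul]
      _ ≤ ∑ j, P m j * v j :=
        Finset.sum_le_sum fun j _ => mul_le_mul_of_nonneg_left (hm j) (hP0 m j)
  have h2 := hv m
  obtain ⟨h3, h4⟩ := ha m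
  have h5 : 0 ≤ a m * v m := by nlinarith
  exact (nonneg_of_mul_nonneg_right h5 h3).trans (hm k)

lemma aux_unit {V : Type*} [Fintype V] [DecidableEq V] [Nonempty V] (P : Matrix V V ℝ)
    (hP0 : ∀ i j, 0 ≤ P i j) (hP1 : ∀ i, ∑ j, P i j = 1)
    (a : V → ℝ) (ha : ∀ i, a i ∈ Set.Ioo (0 : ℝ) 1) :
    IsUnit (1 - (1 - diagonal a) * P) := by
  rw [← mulVec_injective_iff_isUnit]
  intro u v huv
  have key : ∀ u v : V → ℝ, (1 - (1 - diagonal a) * P) *ᵥ u = (1 - (1 - diagonal a) * P) *ᵥ v →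
      ∀ k, 0 ≤ (u - v) k := by
    intro u v huv
    apply aux_nonneg P hP0 hP1 a ha
    intro k
    rw [← aux_mulVec, mulVec_sub, huv, sub_self]
    simp
  ext k
  have h1 := key u v huv k
  have h2 := key v u huv.symm k
  simp only [Pi.sub_apply] at h1 h2
  linarith

lemma aux_pos {V : Type*} [Fintype V] [DecidableEq V] (P : Matrix V V ℝ)
    (hP0 : ∀ i j, 0 ≤ P i j)
    (hPirr : ∀ i j, ∃ t : ℕ, 1 ≤ t ∧ 0 < (P ^ t) i j)
    (a : V → ℝ) (ha : ∀ i, a i ∈ Set.Ioo (0 : ℝ) 1) (i : V) (y : V → ℝ) (hy0 : ∀ k, 0 ≤ y k)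
    (hy : ∀ k, y k - (1 - a k) * (P *ᵥ y) k = (Pi.single i 1 : V → ℝ) k) (k : V) : 0 < y k := by
  have hPy : ∀ k, 0 ≤ (P *ᵥ y) k := fun k =>
    Finset.sum_nonneg fun j _ => mul_nonneg (hP0 k j) (hy0 j)
  have hi : 0 < y i := by
    have := hy i
    rw [Pi.single_eq_same] at this
    have h2 := mul_nonneg (sub_nonneg.2 (ha i).2.le) (hPy i)
    linarith
  have step : ∀ k, y k = 0 → ∀ j, 0 < P k j → y j = 0 := by
    intro k hk j hj
    have h1 := hy k
    have h3 : 0 ≤ (Pi.single i 1 : V → ℝ) k := by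
      by_cases h : k = i
      · subst h; simp
      · simp [h]
    have h4 : 0 < 1 - a k := sub_pos.2 (ha k).2
    have h5 : (P *ᵥ y) k = 0 := by
      have := hPy k
      nlinarith
    have h6 : P k j * y j = 0 :=
      (Finset.sum_eq_zero_iff_of_nonneg
        (fun j _ => mul_nonneg (hP0 k j) (hy0 j))).1 h5 j (Finset.mem_univ j)
    exact (mul_eq_zero.1 h6).resolve_left hj.ne'
  have steps : ∀ t : ℕ, ∀ k, y k = 0 → ∀ j, 0 < (P ^ t) k j → y j = 0 := by
    intro t
    induction t with
    | zero =>
      intro k hk j hj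
      by_cases h : k = j
      · exact h ▸ hk
      · simp [one_apply_ne h] at hj
    | succ t ih =>
      intro k hk j hj
      rw [pow_succ', mul_apply] at hj
      obtain ⟨l, -, hl⟩ := Finset.exists_lt_of_sum_lt
        (s := Finset.univ) (f := fun _ : V => (0:ℝ)) (by simpa using hj)
      have h1 : 0 < P k l := by
        refine lt_of_le_of_ne (hP0 k l) fun h => ?_
        rw [← h] at hl; simp at hl
      exact ih l (step k hk l h1) j (pos_of_mul_pos_right hl h1.le)
  refine lt_of_le_of_ne (hy0 k) fun h => ?_
  obtain ⟨t, -, ht⟩ := hPirr k i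
  exact hi.ne' (steps t k h.symm i ht)

lemma aux_sign {c x : ℝ} (hc : 0 < c) : Real.sign (c * x) = Real.sign x := by
  rcases lt_trichotomy x 0 with h | h | h
  · rw [Real.sign_of_neg h, Real.sign_of_neg (mul_neg_of_pos_of_neg hc h)]
  · simp [h]
  · rw [Real.sign_of_pos h, Real.sign_of_pos (mul_pos hc h)]

lemma aux_main {V : Type*} [Fintype V] [DecidableEq V] [Nonempty V]
    (P : Matrix V V ℝ)
    (hP0 : ∀ i j, 0 ≤ P i j) (hP1 : ∀ i, ∑ j, P i j = 1)
    (hPirr : ∀ i j, ∃ t : ℕ, 1 ≤ t ∧ 0 < (P ^ t) i j)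
    (s : V → ℝ)
    (α : V → ℝ) (hα : ∀ i, α i ∈ Set.Ioo (0 : ℝ) 1)
    (z : (V → ℝ) → V → ℝ)
    (hz : ∀ a : V → ℝ, z a = (1 - (1 - diagonal a) * P)⁻¹ *ᵥ (diagonal a *ᵥ s)) (i : V) :
    ∃ y : V → ℝ, (∀ k, 0 < y k) ∧ ∀ k,
      HasDerivAt (fun x : ℝ => z (Function.update α i x) k) (y k * (s i - z α i)) (α i) := by
  have hu := fun a ha => (Matrix.isUnit_iff_isUnit_det _).1 (aux_unit P hP0 hP1 a ha)
  have hzeq : ∀ a : V → ℝ, (∀ i, a i ∈ Set.Ioo (0 : ℝ) 1) →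
      ∀ k, z a k - (1 - a k) * (P *ᵥ z a) k = a k * s k := by
    intro a ha k
    rw [← aux_mulVec, hz, mulVec_mulVec, mul_nonsing_inv _ (hu a ha), one_mulVec, mulVec_diagonal]
  have huniq : ∀ a : V → ℝ, (∀ i, a i ∈ Set.Ioo (0 : ℝ) 1) → ∀ w : V → ℝ,
      (∀ k, w k - (1 - a k) * (P *ᵥ w) k = a k * s k) → z a = w := by
    intro a ha w hw
    apply mulVec_injective_iff_isUnit.2 (aux_unit P hP0 hP1 a ha)
    ext k
    rw [aux_mulVec, aux_mulVec, hw, hzeq a ha]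
  obtain ⟨y, hy⟩ : ∃ y : V → ℝ,
      ∀ k, y k - (1 - α k) * (P *ᵥ y) k = (Pi.single i 1 : V → ℝ) k := by
    refine ⟨(1 - (1 - diagonal α) * P)⁻¹ *ᵥ (Pi.single i 1), fun k => ?_⟩
    rw [← aux_mulVec, mulVec_mulVec, mul_nonsing_inv _ (hu α hα), one_mulVec]
  have hy0 : ∀ k, 0 ≤ y k := by
    apply aux_nonneg P hP0 hP1 α hα
    intro k
    rw [hy]
    by_cases h : k = i
    · subst h; simp
    · simp [h]
  have hypos := aux_pos P hP0 hPirr α hα i y hy0 hy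
  have h1α : 0 < 1 - α i := sub_pos.2 (hα i).2
  refine ⟨fun k => y k / (1 - α i), fun k => div_pos (hypos k) h1α, fun k => ?_⟩
  set g := s i - (P *ᵥ z α) i with hg
  set c := (P *ᵥ y) i with hc
  have hsg : y k / (1 - α i) * (s i - z α i) = y k * g := by
    have := hzeq α hα i
    have h2 : s i - z α i = (1 - α i) * g := by rw [hg]; linarith
    rw [h2]; field_simp
  rw [hsg]
  have hd : HasDerivAt (fun x : ℝ => z α k + (x - α i) * g / (1 + (x - α i) * c) * y k)
      (y k * g) (α i) := by
    have h0 : HasDerivAt (fun x : ℝ => x - α i) 1 (α i) := (hasDerivAt_id _).sub_const _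
    have h1 := (((h0.mul_const g).div ((h0.mul_const c).const_add 1) (by simp)).mul_const
      (y k)).const_add (z α k)
    refine h1.congr_deriv ?_
    simp
    ring
  refine hd.congr_of_eventuallyEq ?_
  have e1 : ∀ᶠ x in nhds (α i), x ∈ Set.Ioo (0:ℝ) 1 := isOpen_Ioo.mem_nhds (hα i)
  have e2 : ∀ᶠ x in nhds (α i), 1 + (x - α i) * c ≠ 0 := by
    have : ContinuousAt (fun x : ℝ => 1 + (x - α i) * c) (α i) := by fun_prop
    exact this.eventually_ne (by simp)
  filter_upwards [e1, e2] with x hx1 hx2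
  have hw := huniq (Function.update α i x) (fun j => by
    by_cases h : j = i
    · subst h; simpa using hx1
    · simpa [h] using hα j) (z α + ((x - α i) * g / (1 + (x - α i) * c)) • y) ?_
  · rw [hw]; simp
  · intro j
    rw [mulVec_add, mulVec_smul]
    simp only [Pi.add_apply, Pi.smul_apply, smul_eq_mul]
    have a1 := hzeq α hα j
    have a2 := hy j
    by_cases h : j = i
    · subst h
      rw [Pi.single_eq_same] at a2
      rw [Function.update_self, ← hc]
      rw [← hc] at a2
      have a3 : z α j = α j * s j + (1 - α j) * (P *ᵥ z α) j := by linarith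
      have a4 : y j = 1 + (1 - α j) * c := by linarith
      have a5 : (P *ᵥ z α) j = s j - g := by rw [hg]; ring
      rw [a3, a4, a5]
      field_simp
      ring
    · rw [Function.update_of_ne h]
      rw [Pi.single_eq_of_ne h] at a2
      linear_combination a1 + ((x - α i) * g / (1 + (x - α i) * c)) * a2



/-- Lemma (Sign of Partial Derivative): for every `i, k`, the partial derivative
`∂z_k(α)/∂α_i` has exactly the same sign (in `{−,0,+}`) as `s_i − z_i(α)`; consequently
`∂f(α)/∂α_i = Σ_k ∂z_k(α)/∂α_i` also has the same sign as `s_i − z_i(α)`, where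
`f(α) = 1ᵀ z(α)`. -/
theorem stmt5 {V : Type*} [Fintype V] [DecidableEq V] [Nonempty V]
    (P : Matrix V V ℝ)
    (hP0 : ∀ i j, 0 ≤ P i j) (hP1 : ∀ i, ∑ j, P i j = 1)
    (hPirr : ∀ i j, ∃ t : ℕ, 1 ≤ t ∧ 0 < (P ^ t) i j)
    (s : V → ℝ) (hs : ∀ i, s i ∈ Set.Icc (0 : ℝ) 1)
    (α : V → ℝ) (hα : ∀ i, α i ∈ Set.Ioo (0 : ℝ) 1)
    (z : (V → ℝ) → V → ℝ)
    (hz : ∀ a : V → ℝ, z a = (1 - (1 - diagonal a) * P)⁻¹ *ᵥ (diagonal a *ᵥ s)) :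
    (∀ i k : V, ∃ d : ℝ,
        HasDerivAt (fun x : ℝ => z (Function.update α i x) k) d (α i) ∧
        Real.sign d = Real.sign (s i - z α i)) ∧
    (∀ i : V, ∃ d : ℝ,
        HasDerivAt (fun x : ℝ => ∑ k, z (Function.update α i x) k) d (α i) ∧
        Real.sign d = Real.sign (s i - z α i)) := by
  have main := aux_main P hP0 hP1 hPirr s α hα z hz
  refine ⟨fun i k => ?_, fun i => ?_⟩
  · obtain ⟨y, hy, hd⟩ := main i
    exact ⟨_, hd k, aux_sign (hy k)⟩
  · obtain ⟨y, hy, hd⟩ := main i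
    refine ⟨_, HasDerivAt.fun_sum fun k _ => hd k, ?_⟩
    rw [← Finset.sum_mul]
    exact aux_sign (Finset.sum_pos (fun k _ => hy k) Finset.univ_nonempty)
end

section
/- Let α ∈ (0,1)^V, let P be an irreducible row-stochastic matrix, s ∈ [0,1]^V, M(α) = [I − (I − A)P]^{−1}, z(α) = M(α) A s, and f(α) = 1ᵀ z(α). Define r(α)ᵀ = 1ᵀ M(α). Then for every i ∈ V, the partial derivative of f with respect to α_i satisfies ∂f(α)/∂α_i = r_i(α) · (s_i − z_i(α)) / (1 − α_i). -/
open Matrix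

lemma stmt6_det {V : Type*} [Fintype V] [DecidableEq V]
    (P : Matrix V V ℝ)
    (hP0 : ∀ i j, 0 ≤ P i j) (hP1 : ∀ i, ∑ j, P i j = 1)
    (a : V → ℝ) (ha : ∀ i, a i ∈ Set.Ioo (0 : ℝ) 1) :
    (1 - (1 - diagonal a) * P).det ≠ 0 := by
  have hB : ∀ k j, (1 - (1 - diagonal a) * P) k j =
      (1 : Matrix V V ℝ) k j - (1 - a k) * P k j := by
    intro k j
    simp [sub_mul, Matrix.sub_apply, diagonal_mul]
  apply det_ne_zero_of_sum_row_lt_diag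
  intro k
  obtain ⟨h0, h1⟩ := ha k
  have hsum := Finset.add_sum_erase Finset.univ (fun j => P k j) (Finset.mem_univ k)
  simp only [hP1 k] at hsum
  have h2 : ∑ j ∈ Finset.univ.erase k, ‖(1 - (1 - diagonal a) * P) k j‖
      = (1 - a k) * ∑ j ∈ Finset.univ.erase k, P k j := by
    rw [Finset.mul_sum]
    refine Finset.sum_congr rfl fun j hj => ?_
    rw [hB, one_apply_ne (Finset.ne_of_mem_erase hj).symm, zero_sub, norm_neg,
      Real.norm_of_nonneg (mul_nonneg (by linarith) (hP0 k j))]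
  rw [h2, hB, one_apply_eq]
  refine lt_of_lt_of_le ?_ (Real.le_norm_self _)
  have : ∑ j ∈ Finset.univ.erase k, P k j = 1 - P k k := by linarith
  rw [this]
  nlinarith

/-- With `r(α)ᵀ = 1ᵀ M(α)`, i.e. `r_i(α) = Σ_k M(α)_{ki}`, the partial derivative of the
objective `f(α) = 1ᵀ z(α)` satisfies `∂f(α)/∂α_i = r_i(α) (s_i − z_i(α)) / (1 − α_i)`. -/
theorem stmt6 {V : Type*} [Fintype V] [DecidableEq V] [Nonempty V]
    (P : Matrix V V ℝ)
    (hP0 : ∀ i j, 0 ≤ P i j) (hP1 : ∀ i, ∑ j, P i j = 1)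
    (hPirr : ∀ i j, ∃ t : ℕ, 1 ≤ t ∧ 0 < (P ^ t) i j)
    (s : V → ℝ) (hs : ∀ i, s i ∈ Set.Icc (0 : ℝ) 1)
    (α : V → ℝ) (hα : ∀ i, α i ∈ Set.Ioo (0 : ℝ) 1)
    (M : (V → ℝ) → Matrix V V ℝ)
    (hM : ∀ a : V → ℝ, M a = (1 - (1 - diagonal a) * P)⁻¹)
    (z : (V → ℝ) → V → ℝ)
    (hz : ∀ a : V → ℝ, z a = M a *ᵥ (diagonal a *ᵥ s))
    (f : (V → ℝ) → ℝ) (hf : ∀ a : V → ℝ, f a = ∑ k, z a k)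
    (r : (V → ℝ) → V → ℝ) (hr : ∀ (a : V → ℝ) (i : V), r a i = ∑ k, M a k i) :
    ∀ i : V,
      HasDerivAt (fun x : ℝ => f (Function.update α i x))
        (r α i * (s i - z α i) / (1 - α i)) (α i) := by
  intro i
  have hB : ∀ (a : V → ℝ) (v : V → ℝ) (k : V), ((1 - (1 - diagonal a) * P) *ᵥ v) k =
      v k - (1 - a k) * (P *ᵥ v) k := by
    intro a v k
    rw [sub_mulVec, one_mulVec, ← mulVec_mulVec, sub_mulVec, one_mulVec]
    simp only [Pi.sub_apply, mulVec_diagonal]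
    ring
  have hBz : ∀ a : V → ℝ, (1 - (1 - diagonal a) * P).det ≠ 0 → ∀ k,
      z a k - (1 - a k) * (P *ᵥ z a) k = a k * s k := by
    intro a ha k
    rw [← hB, hz, hM, mulVec_mulVec, mul_nonsing_inv _ (isUnit_iff_ne_zero.mpr ha), one_mulVec,
      mulVec_diagonal]
  have hdet := stmt6_det P hP0 hP1
  have key : ∀ x : ℝ, x ∈ Set.Ioo (0 : ℝ) 1 →
      f (Function.update α i x) - f α =
        (x - α i) * (r (Function.update α i x) i * (s i - (P *ᵥ z α) i)) := by
    intro x hx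
    set a := Function.update α i x with ha
    have haI : ∀ k, a k ∈ Set.Ioo (0 : ℝ) 1 := by
      intro k
      by_cases hk : k = i
      · subst hk; simpa [ha] using hx
      · simpa [ha, hk] using hα k
    have e1 : (1 - (1 - diagonal a) * P) *ᵥ (z a - z α) =
        Pi.single i ((x - α i) * (s i - (P *ᵥ z α) i)) := by
      ext k
      have h1 := hBz a (hdet a haI) k
      have h2 := hBz α (hdet α hα) k
      rw [hB, mulVec_sub]
      simp only [Pi.sub_apply]
      by_cases hk : k = i
      · subst hk
        have : a k = x := by simp [ha]
        rw [this] at h1 ⊢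
        rw [Pi.single_eq_same]
        linear_combination h1 - h2
      · have : a k = α k := by simp [ha, hk]
        rw [this] at h1 ⊢
        rw [Pi.single_eq_of_ne hk]
        linear_combination h1 - h2
    have e2 : z a - z α = M a *ᵥ Pi.single i ((x - α i) * (s i - (P *ᵥ z α) i)) := by
      rw [← e1, hM, mulVec_mulVec, nonsing_inv_mul _ (isUnit_iff_ne_zero.mpr (hdet a haI)),
        one_mulVec]
    rw [hf, hf, ← Finset.sum_sub_distrib, hr, Finset.sum_mul, Finset.mul_sum]
    refine Finset.sum_congr rfl fun k _ => ?_
    have := congrFun e2 k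
    rw [Pi.sub_apply] at this
    rw [this, mulVec_single]
    simp
    ring
  have hcont : ContinuousAt (fun x : ℝ => r (Function.update α i x) i) (α i) := by
    have hBc : Continuous (fun x : ℝ => 1 - (1 - diagonal (Function.update α i x)) * P) := by
      have : Continuous (fun x : ℝ => Function.update α i x) :=
        continuous_const.update i continuous_id
      exact continuous_const.sub
        ((continuous_const.sub this.matrix_diagonal).matrix_mul continuous_const)
    simp only [hr, hM, inv_def, Ring.inverse_eq_inv', Matrix.smul_apply, smul_eq_mul]
    refine tendsto_finsetSum _ fun k _ => ?_
    refine ContinuousAt.mul (ContinuousAt.inv₀ hBc.matrix_det.continuousAt ?_)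
      (hBc.matrix_adjugate.matrix_elem k i).continuousAt
    rw [Function.update_eq_self]
    exact hdet α hα
  have hval : r α i * (s i - z α i) / (1 - α i) = r α i * (s i - (P *ᵥ z α) i) := by
    have h2 := hBz α (hdet α hα) i
    have h3 : 1 - α i ≠ 0 := by linarith [(hα i).2]
    rw [div_eq_iff h3]
    linear_combination (-r α i) * h2
  rw [hval, hasDerivAt_iff_tendsto_slope]
  have hlim : Filter.Tendsto
      (fun x : ℝ => r (Function.update α i x) i * (s i - (P *ᵥ z α) i))
      (nhdsWithin (α i) {α i}ᶜ) (nhds (r α i * (s i - (P *ᵥ z α) i))) := by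
    have := (hcont.mul_const (s i - (P *ᵥ z α) i)).tendsto
    simp only [Function.update_eq_self] at this
    exact this.mono_left nhdsWithin_le_nhds
  refine hlim.congr' ?_
  filter_upwards [self_mem_nhdsWithin,
    mem_nhdsWithin_of_mem_nhds (Ioo_mem_nhds (hα i).1 (hα i).2)] with x hx hx'
  have h3 : x - α i ≠ 0 := sub_ne_zero.mpr hx
  rw [slope_def_field, Function.update_eq_self, key x hx', mul_div_cancel_left₀ _ h3]
end

section
/- Let α ∈ (0,1)^V, let P be an irreducible row-stochastic matrix, let i, k ∈ V with i ≠ k, and let R = [I − (I − A_{−{i,k}})P]^{−1}. Then R_{ii} = max_{j∈V} R_{ji}, i.e., the diagonal entry is the maximum of its column. Moreover, R_{ii} = R_{ki} if and only if P_{kk} + P_{ki} = 1. -/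
open Matrix

lemma aux_local {V : Type*} [Fintype V] (p x : V → ℝ) (d m : ℝ)
    (hp : ∀ l, 0 ≤ p l) (hp1 : ∑ l, p l = 1) (hd1 : d ≤ 1) (hd0 : 0 ≤ d)
    (hx : ∀ l, x l ≤ m) (hm : 0 < m) (h : m ≤ d * ∑ l, p l * x l) :
    d = 1 ∧ ∀ l, 0 < p l → x l = m := by
  have hs : ∑ l, p l * (m - x l) = m - ∑ l, p l * x l := by
    simp only [mul_sub, Finset.sum_sub_distrib, ← Finset.sum_mul, hp1, one_mul]
  have hnn : ∀ l ∈ Finset.univ, 0 ≤ p l * (m - x l) :=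
    fun l _ => mul_nonneg (hp l) (sub_nonneg.2 (hx l))
  have h0 : 0 ≤ ∑ l, p l * (m - x l) := Finset.sum_nonneg hnn
  have hle : ∑ l, p l * x l ≤ m := by linarith
  have h2 : d * ∑ l, p l * x l ≤ d * m := mul_le_mul_of_nonneg_left hle hd0
  have hd : d = 1 := by
    by_contra hne
    have : d < 1 := lt_of_le_of_ne hd1 hne
    nlinarith
  refine ⟨hd, fun l hl => ?_⟩
  subst hd
  have hz : ∑ l, p l * (m - x l) = 0 := by linarith
  have := (Finset.sum_eq_zero_iff_of_nonneg hnn).1 hz l (Finset.mem_univ l)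
  rcases mul_eq_zero.1 this with h | h <;> linarith

lemma aux_closed {V : Type*} [Fintype V] [DecidableEq V] (P : Matrix V V ℝ)
    (hP0 : ∀ i j, 0 ≤ P i j)
    (hPirr : ∀ i j, ∃ t : ℕ, 1 ≤ t ∧ 0 < (P ^ t) i j) (S : V → Prop)
    (hS : ∀ j, S j → ∀ l, 0 < P j l → S l) (j : V) (hj : S j) (l : V) : S l := by
  have key : ∀ t : ℕ, ∀ l, (P ^ t) j l ≠ 0 → S l := by
    intro t
    induction t with
    | zero =>
      intro l h
      by_cases hjl : j = l
      · exact hjl ▸ hj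
      · simp [Matrix.one_apply, hjl] at h
    | succ t ih =>
      intro l h
      rw [pow_succ, Matrix.mul_apply] at h
      obtain ⟨c, _, hc⟩ := Finset.exists_ne_zero_of_sum_ne_zero h
      exact hS c (ih c (left_ne_zero_of_mul hc)) l
        (lt_of_le_of_ne (hP0 c l) (right_ne_zero_of_mul hc).symm)
  obtain ⟨t, _, ht⟩ := hPirr j l
  exact key t l ht.ne'

lemma aux_sub {V : Type*} [Fintype V] [DecidableEq V] [Nonempty V] (P : Matrix V V ℝ)
    (hP0 : ∀ i j, 0 ≤ P i j) (hP1 : ∀ i, ∑ j, P i j = 1)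
    (hPirr : ∀ i j, ∃ t : ℕ, 1 ≤ t ∧ 0 < (P ^ t) i j)
    (d : V → ℝ) (hd0 : ∀ j, 0 ≤ d j) (hd1 : ∀ j, d j ≤ 1) (j0 : V) (hj0 : d j0 < 1)
    (x : V → ℝ) (hx : ∀ j, x j ≤ d j * ∑ l, P j l * x l) (j : V) : x j ≤ 0 := by
  obtain ⟨a, ha⟩ := Finite.exists_max x
  by_contra hj
  have hm : 0 < x a := lt_of_lt_of_le (not_le.1 hj) (ha j)
  have loc : ∀ b, x b = x a → d b = 1 ∧ ∀ l, 0 < P b l → x l = x a := fun b hb =>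
    aux_local (P b) x (d b) (x a) (hP0 b) (hP1 b) (hd1 b) (hd0 b) ha hm (hb ▸ hx b)
  have := aux_closed P hP0 hPirr (fun b => x b = x a) (fun b hb => (loc b hb).2) a rfl j0
  linarith [(loc j0 this).1]

/-- Lemma (Diagonal Entry): for `R = [I − (I − A_{−{i,k}})P]⁻¹`, the diagonal entry
`R_{ii}` is the maximum of the `i`-th column, and `R_{ii} = R_{ki}` iff
`P_{kk} + P_{ki} = 1`. -/
theorem stmt10 {V : Type*} [Fintype V] [DecidableEq V] [Nonempty V]
    (P : Matrix V V ℝ)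
    (hP0 : ∀ i j, 0 ≤ P i j) (hP1 : ∀ i, ∑ j, P i j = 1)
    (hPirr : ∀ i j, ∃ t : ℕ, 1 ≤ t ∧ 0 < (P ^ t) i j)
    (α : V → ℝ) (hα : ∀ i, α i ∈ Set.Ioo (0 : ℝ) 1)
    (i k : V) (hik : i ≠ k)
    (R : Matrix V V ℝ)
    (hR : R = (1 - (1 - diagonal (fun j => if j = i ∨ j = k then 0 else α j)) * P)⁻¹) :
    (∀ j : V, R j i ≤ R i i) ∧
    (R i i = R k i ↔ P k k + P k i = 1) := by
  obtain ⟨d, hd⟩ : ∃ d : V → ℝ, d = fun j => 1 - (if j = i ∨ j = k then 0 else α j) := ⟨_, rfl⟩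
  have hD : (1 - diagonal (fun j => if j = i ∨ j = k then 0 else α j) : Matrix V V ℝ)
      = diagonal d := by
    rw [hd, ← diagonal_one, diagonal_sub]
  rw [hD] at hR
  have hdi : d i = 1 := by simp [hd]
  have hdk : d k = 1 := by simp [hd]
  have hdo : ∀ j, j ≠ i → j ≠ k → d j < 1 := by
    intro j h1 h2
    simp [hd, h1, h2, (hα j).1]
  have hd0 : ∀ j, 0 ≤ d j := by
    intro j
    simp only [hd]
    split_ifs <;> linarith [(hα j).2]
  have hd1 : ∀ j, d j ≤ 1 := by
    intro j
    simp only [hd]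
    split_ifs <;> linarith [(hα j).1]
  have hmv : ∀ (x : V → ℝ) (j : V), ((1 - diagonal d * P) *ᵥ x) j
      = x j - d j * ∑ l, P j l * x l := by
    intro x j
    rw [sub_mulVec, one_mulVec, ← mulVec_mulVec, Pi.sub_apply, mulVec_diagonal]
    rfl
  have hkk : P k i = 0 → P k k = 1 → False := by
    intro h0 h1
    have : ∀ l, 0 < P k l → l = k := by
      intro l hl
      by_contra hne
      have h2 : P k k + P k l ≤ ∑ j, P k j := by
        rw [← Finset.sum_pair (Ne.symm hne)]
        exact Finset.sum_le_sum_of_subset_of_nonneg (Finset.subset_univ _)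
          (fun j _ _ => hP0 k j)
      rw [hP1] at h2
      linarith
    exact hik (aux_closed P hP0 hPirr (fun b => b = k) (fun b hb l hl => this l (hb ▸ hl)) k rfl i)
  have hsumpair : ∀ f : V → ℝ, (∀ l, l ≠ i → l ≠ k → f l = 0) → ∑ l, f l = f i + f k := by
    intro f hf
    rw [← Finset.sum_pair hik]
    symm
    apply Finset.sum_subset (Finset.subset_univ _)
    intro l _ hl
    simp only [Finset.mem_insert, Finset.mem_singleton, not_or] at hl
    exact hf l hl.1 hl.2
  by_cases hex : ∃ j0, j0 ≠ i ∧ j0 ≠ k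
  swap
  · push Not at hex
    have hall : ∀ j, d j = 1 := by
      intro j
      by_cases h : j = i
      · rw [h, hdi]
      · rw [hex j h, hdk]
    have hdet : (1 - diagonal d * P).det = 0 := by
      rw [← Matrix.exists_mulVec_eq_zero_iff]
      refine ⟨fun _ => 1, fun h => one_ne_zero (congrFun h i), ?_⟩
      ext j
      rw [hmv, hall]
      simp [hP1]
    have hR0 : R = 0 := by
      rw [hR, Matrix.nonsing_inv_apply_not_isUnit]
      simp [hdet]
    have hs := hsumpair (P k) (fun l h1 h2 => absurd (hex l h1) h2)
    rw [hP1] at hs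
    simp only [hR0, Matrix.zero_apply, le_refl, implies_true, true_and, true_iff]
    linarith
  · obtain ⟨j0, hj0i, hj0k⟩ := hex
    have sub := aux_sub P hP0 hP1 hPirr d hd0 hd1 j0 (hdo j0 hj0i hj0k)
    have hdet : (1 - diagonal d * P).det ≠ 0 := by
      intro h
      obtain ⟨v, hv, hv0⟩ := Matrix.exists_mulVec_eq_zero_iff.2 h
      apply hv
      have hh : ∀ j, v j - d j * ∑ l, P j l * v l = 0 := fun j => by
        rw [← hmv, hv0]; rfl
      ext j
      have h1 := sub v (fun j => by linarith [hh j]) j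
      have h2 := sub (fun j => - v j) (fun j => by
        simp only [mul_neg, Finset.sum_neg_distrib]
        linarith [hh j]) j
      simp only [Pi.zero_apply]
      linarith
    have hMR : (1 - diagonal d * P) * R = 1 := by
      rw [hR]
      exact Matrix.mul_nonsing_inv _ (isUnit_iff_ne_zero.2 hdet)
    obtain ⟨x, hxdef⟩ : ∃ x : V → ℝ, x = fun j => R j i := ⟨_, rfl⟩
    have hx : ∀ j, x j = d j * ∑ l, P j l * x l + (if j = i then 1 else 0) := by
      intro j
      have h1 := hmv x j
      have h2 : ((1 - diagonal d * P) *ᵥ x) j = (1 : Matrix V V ℝ) j i := by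
        rw [hxdef]; exact congrFun (congrFun hMR j) i
      rw [h2, Matrix.one_apply] at h1
      linarith
    have hRx : ∀ j, R j i = x j := fun j => by rw [hxdef]
    simp only [hRx]
    have hnn : ∀ j, 0 ≤ x j := by
      intro j
      have := sub (fun j => - x j) (fun j => by
        simp only [mul_neg, Finset.sum_neg_distrib]
        have := hx j
        split_ifs at this <;> linarith) j
      linarith
    have hxi : 0 < x i := by
      have h1 := hx i
      have h2 : 0 ≤ ∑ l, P i l * x l := Finset.sum_nonneg fun l _ => mul_nonneg (hP0 i l) (hnn l)
      rw [hdi, if_pos rfl] at h1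
      linarith
    have hmax : ∀ j, x j ≤ x i := by
      obtain ⟨a, ha⟩ := Finite.exists_max x
      suffices h : x i = x a by rw [h]; exact ha
      by_contra hne
      have hm : 0 < x a := lt_of_lt_of_le hxi (ha i)
      refine hne (aux_closed P hP0 hPirr (fun b => x b = x a) (fun b hb => ?_) a rfl i)
      have hbi : b ≠ i := fun h => hne (h ▸ hb)
      have hxb := hx b
      rw [if_neg hbi, add_zero, hb] at hxb
      exact (aux_local (P b) x (d b) (x a) (hP0 b) (hP1 b) (hd1 b) (hd0 b) ha hm hxb.le).2
    have hxk := hx k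
    rw [if_neg hik.symm, add_zero, hdk] at hxk
    refine ⟨hmax, fun h => ?_, fun h => ?_⟩
    · have hs := hsumpair (P k) (fun l h1 h2 => by
        by_contra h0
        have hl := (aux_local (P k) x 1 (x i) (hP0 k) (hP1 k) le_rfl zero_le_one hmax hxi
          (by rw [← hxk, h])).2 l (lt_of_le_of_ne (hP0 k l) (Ne.symm h0))
        have hxl := hx l
        rw [if_neg h1, add_zero, hl] at hxl
        have := (aux_local (P l) x (d l) (x i) (hP0 l) (hP1 l) (hd1 l) (hd0 l) hmax hxi hxl.le).1
        linarith [hdo l h1 h2])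
      rw [hP1] at hs
      linarith
    · have hz : ∀ l, l ≠ i → l ≠ k → P k l = 0 := by
        intro l h1 h2
        have h3 : P k i + (P k k + P k l) ≤ ∑ j, P k j := by
          rw [← Finset.sum_pair (Ne.symm h2), ← Finset.sum_insert (by simp [hik, Ne.symm h1])]
          exact Finset.sum_le_sum_of_subset_of_nonneg (Finset.subset_univ _)
            (fun j _ _ => hP0 k j)
        rw [hP1] at h3
        linarith [hP0 k l]
      rw [hsumpair _ (fun l h1 h2 => by rw [hz l h1 h2, zero_mul])] at hxk
      have h4 : P k i * (x i - x k) = 0 := by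
        have : P k k = 1 - P k i := by linarith
        rw [this] at hxk
        linarith
      rcases mul_eq_zero.1 h4 with h5 | h5
      · exact (hkk h5 (by linarith)).elim
      · linarith
end

section
/- (Switching Lemma) Let P be an irreducible row-stochastic matrix on a set V with |V| ≥ 3, and s ∈ [0,1]^V. Let α, β ∈ (0,1)^V be resistance vectors that differ in exactly two coordinates i ≠ k. Writing f(x, y) for the value of f at the vector that equals α off {i,k} and has coordinate i equal to x and coordinate k equal to y, suppose that min{f(α_i, α_k), f(β_i, β_k)} < min{f(α_i, β_k), f(β_i, α_k)}. Then max{f(α_i, α_k), f(β_i, β_k)} > min{f(α_i, β_k), f(β_i, α_k)}. -/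
open Matrix

/-- `z` is an equilibrium for resistance vector `a`. -/
def SwEq {V : Type*} [Fintype V] (P : Matrix V V ℝ) (s a z : V → ℝ) : Prop :=
  ∀ j, z j = a j * s j + (1 - a j) * ∑ l, P j l * z l

/-- Minimum principle. -/
lemma sw_nonneg {V : Type*} [Fintype V] (P : Matrix V V ℝ)
    (hP0 : ∀ i j, 0 ≤ P i j) (hP1 : ∀ i, ∑ j, P i j = 1)
    (a d e : V → ℝ) (ha : ∀ j, a j ∈ Set.Ioo (0 : ℝ) 1)
    (hd : ∀ j, d j = (1 - a j) * (∑ l, P j l * d l) + e j)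
    (he : ∀ j, 0 ≤ e j) (j : V) : 0 ≤ d j := by
  haveI : Nonempty V := ⟨j⟩
  obtain ⟨m, hm⟩ := Finite.exists_min d
  have h1 : d m ≤ ∑ l, P m l * d l := by
    calc d m = ∑ l, P m l * d m := by rw [← Finset.sum_mul, hP1, one_mul]
      _ ≤ _ := Finset.sum_le_sum fun l _ => mul_le_mul_of_nonneg_left (hm l) (hP0 m l)
  have h2 : (1 - a m) * d m ≤ (1 - a m) * ∑ l, P m l * d l :=
    mul_le_mul_of_nonneg_left h1 (by linarith [(ha m).2])
  have h3 : 0 ≤ a m * d m := by nlinarith [hd m, he m]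
  have h4 : 0 ≤ d m := nonneg_of_mul_nonneg_right h3 (ha m).1
  exact h4.trans (hm j)

/-- Comparison of two equilibria whose resistances differ at most at `i`. -/
lemma sw_edge {V : Type*} [Fintype V] [DecidableEq V] (P : Matrix V V ℝ)
    (hP0 : ∀ i j, 0 ≤ P i j) (hP1 : ∀ i, ∑ j, P i j = 1)
    (s a a' z z' : V → ℝ) (ha' : ∀ j, a' j ∈ Set.Ioo (0 : ℝ) 1)
    (i : V) (hne : ∀ j, j ≠ i → a j = a' j)
    (hz : SwEq P s a z) (hz' : SwEq P s a' z') :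
    (0 ≤ (a' i - a i) * (s i - ∑ l, P i l * z l) → ∀ j, z j ≤ z' j) ∧
    ((a' i - a i) * (s i - ∑ l, P i l * z l) ≤ 0 → ∀ j, z' j ≤ z j) ∧
    (0 < (a' i - a i) * (s i - ∑ l, P i l * z l) → ∑ j, z j < ∑ j, z' j) ∧
    ((a' i - a i) * (s i - ∑ l, P i l * z l) < 0 → ∑ j, z' j < ∑ j, z j) := by
  set c := (a' i - a i) * (s i - ∑ l, P i l * z l) with hc
  have key : ∀ j, z' j - z j = (1 - a' j) * (∑ l, P j l * (z' l - z l)) +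
      (if j = i then c else 0) := by
    intro j
    have e1 : ∑ l, P j l * (z' l - z l) = ∑ l, P j l * z' l - ∑ l, P j l * z l := by
      rw [← Finset.sum_sub_distrib]
      exact Finset.sum_congr rfl fun l _ => by ring
    rw [e1, hz' j, hz j]
    split_ifs with h
    · subst h; rw [hc]; ring
    · rw [hne j h]; ring
  have key2 : ∀ j, z j - z' j = (1 - a' j) * (∑ l, P j l * (z l - z' l)) +
      (if j = i then -c else 0) := by
    intro j
    have e1 : ∑ l, P j l * (z l - z' l) = - ∑ l, P j l * (z' l - z l) := by
      rw [← Finset.sum_neg_distrib]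
      exact Finset.sum_congr rfl fun l _ => by ring
    have := key j
    rw [e1]
    split_ifs with h
    · rw [if_pos h] at this; linarith
    · rw [if_neg h] at this; linarith
  have A : 0 ≤ c → ∀ j, z j ≤ z' j := fun h j => sub_nonneg.1 <|
    sw_nonneg P hP0 hP1 a' (fun j => z' j - z j) _ ha' key
      (fun j => by split_ifs <;> linarith) j
  have B : c ≤ 0 → ∀ j, z' j ≤ z j := fun h j => sub_nonneg.1 <|
    sw_nonneg P hP0 hP1 a' (fun j => z j - z' j) _ ha' key2
      (fun j => by split_ifs <;> linarith) j
  refine ⟨A, B, fun h => ?_, fun h => ?_⟩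
  · refine Finset.sum_lt_sum (fun j _ => A h.le j) ⟨i, Finset.mem_univ _, ?_⟩
    have h1 : 0 ≤ ∑ l, P i l * (z' l - z l) :=
      Finset.sum_nonneg fun l _ => mul_nonneg (hP0 i l) (sub_nonneg.2 (A h.le l))
    have h2 := mul_nonneg (sub_nonneg.2 (ha' i).2.le) h1
    have h3 := key i
    rw [if_pos rfl] at h3
    linarith
  · refine Finset.sum_lt_sum (fun j _ => B h.le j) ⟨i, Finset.mem_univ _, ?_⟩
    have h1 : 0 ≤ ∑ l, P i l * (z l - z' l) :=
      Finset.sum_nonneg fun l _ => mul_nonneg (hP0 i l) (sub_nonneg.2 (B h.le l))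
    have h2 := mul_nonneg (sub_nonneg.2 (ha' i).2.le) h1
    have h3 := key2 i
    rw [if_pos rfl] at h3
    linarith

/-- The matrix expression for the equilibrium does satisfy the equilibrium equations. -/
lemma sw_exists {V : Type*} [Fintype V] [DecidableEq V] (P : Matrix V V ℝ)
    (hP0 : ∀ i j, 0 ≤ P i j) (hP1 : ∀ i, ∑ j, P i j = 1)
    (s a : V → ℝ) (ha : ∀ j, a j ∈ Set.Ioo (0 : ℝ) 1) :
    SwEq P s a ((1 - (1 - diagonal a) * P)⁻¹ *ᵥ (diagonal a *ᵥ s)) := by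
  have hform : ∀ v : V → ℝ, ∀ j, ((1 - (1 - diagonal a) * P) *ᵥ v) j =
      v j - (1 - a j) * ∑ l, P j l * v l := by
    intro v j
    rw [sub_mulVec, one_mulVec, ← mulVec_mulVec, sub_mulVec, one_mulVec]
    simp only [Pi.sub_apply, mulVec_diagonal]
    simp only [mulVec, dotProduct]
    ring
  have hinj : Function.Injective ((1 - (1 - diagonal a) * P) *ᵥ ·) := by
    have h0 : ∀ v w : V → ℝ, (1 - (1 - diagonal a) * P) *ᵥ v = (1 - (1 - diagonal a) * P) *ᵥ w →
        ∀ j, 0 ≤ v j - w j := by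
      intro v w h
      refine sw_nonneg P hP0 hP1 a (fun j => v j - w j) (fun _ => 0) ha (fun j => ?_)
        (fun _ => le_rfl)
      have h1 := congrFun h j
      rw [hform, hform] at h1
      have e1 : ∑ l, P j l * (v l - w l) = ∑ l, P j l * v l - ∑ l, P j l * w l := by
        rw [← Finset.sum_sub_distrib]
        exact Finset.sum_congr rfl fun l _ => by ring
      rw [e1]
      linarith
    intro v w h
    funext j
    have h1 := h0 v w h j
    have h2 := h0 w v h.symm j
    linarith
  have hu : IsUnit (1 - (1 - diagonal a) * P) := mulVec_injective_iff_isUnit.1 hinj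
  intro j
  have h1 := hform ((1 - (1 - diagonal a) * P)⁻¹ *ᵥ (diagonal a *ᵥ s)) j
  rw [mulVec_mulVec, mul_nonsing_inv _ ((isUnit_iff_isUnit_det _).1 hu), one_mulVec,
    mulVec_diagonal] at h1
  linarith

/-- Core: four equilibria at the corners of a rectangle, `a i < b i`. -/
lemma sw_core {V : Type*} [Fintype V] [DecidableEq V] (P : Matrix V V ℝ)
    (hP0 : ∀ i j, 0 ≤ P i j) (hP1 : ∀ i, ∑ j, P i j = 1)
    (s ac bc ad bd zac zbc zad zbd : V → ℝ)
    (hac : ∀ j, ac j ∈ Set.Ioo (0 : ℝ) 1) (hbc : ∀ j, bc j ∈ Set.Ioo (0 : ℝ) 1)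
    (had : ∀ j, ad j ∈ Set.Ioo (0 : ℝ) 1)
    (i k : V)
    (h1 : ∀ j, j ≠ i → bc j = ac j) (h2 : ∀ j, j ≠ i → bd j = ad j)
    (h3 : ∀ j, j ≠ k → bd j = bc j)
    (hi1 : ac i < bc i) (hi2 : ad i < bd i)
    (eac : SwEq P s ac zac) (ebc : SwEq P s bc zbc)
    (ead : SwEq P s ad zad) (ebd : SwEq P s bd zbd)
    (l1 : ∑ j, zac j ≤ ∑ j, zbc j) (l2 : ∑ j, zbd j ≤ ∑ j, zad j)
    (l3 : ∑ j, zbd j ≤ ∑ j, zbc j) :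
    ∑ j, zbc j ≤ ∑ j, zac j ∧ ∑ j, zad j ≤ ∑ j, zbd j := by
  obtain ⟨p1, -, p3, -⟩ := sw_edge P hP0 hP1 s bc ac zbc zac hac i h1 ebc eac
  obtain ⟨-, q2, -, q4⟩ := sw_edge P hP0 hP1 s bd ad zbd zad had i h2 ebd ead
  obtain ⟨r1, -, -, r4⟩ := sw_edge P hP0 hP1 s bd bc zbd zbc hbc k h3 ebd ebc
  have hle : ∀ j, zbd j ≤ zbc j := by
    apply r1
    by_contra hcon
    exact absurd (r4 (not_le.1 hcon)) (not_lt.2 l3)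
  have hPle : ∑ l, P i l * zbd l ≤ ∑ l, P i l * zbc l :=
    Finset.sum_le_sum fun l _ => mul_le_mul_of_nonneg_left (hle l) (hP0 i l)
  have t1 : ∑ l, P i l * zbc l ≤ s i := by
    by_contra hcon
    exact absurd (p3 (mul_pos_of_neg_of_neg (by linarith) (by linarith))) (not_lt.2 l1)
  have t2 : s i ≤ ∑ l, P i l * zbd l := by
    by_contra hcon
    exact absurd (q4 (mul_neg_of_neg_of_pos (by linarith) (by linarith))) (not_lt.2 l2)
  have u1 : s i - ∑ l, P i l * zbc l = 0 := by linarith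
  have u2 : s i - ∑ l, P i l * zbd l = 0 := by linarith
  rw [u1, mul_zero] at p1
  rw [u2, mul_zero] at q2
  exact ⟨Finset.sum_le_sum fun j _ => p1 le_rfl j, Finset.sum_le_sum fun j _ => q2 le_rfl j⟩

/-- Switching Lemma: if `α, β ∈ (0,1)^V` differ in exactly the two coordinates `i ≠ k`,
and `min{f(α_i,α_k), f(β_i,β_k)} < min{f(α_i,β_k), f(β_i,α_k)}`, then
`max{f(α_i,α_k), f(β_i,β_k)} > min{f(α_i,β_k), f(β_i,α_k)}`. -/
theorem stmt11 {V : Type*} [Fintype V] [DecidableEq V]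
    (hcard : 3 ≤ Fintype.card V)
    (P : Matrix V V ℝ)
    (hP0 : ∀ i j, 0 ≤ P i j) (hP1 : ∀ i, ∑ j, P i j = 1)
    (hPirr : ∀ i j, ∃ t : ℕ, 1 ≤ t ∧ 0 < (P ^ t) i j)
    (s : V → ℝ) (hs : ∀ i, s i ∈ Set.Icc (0 : ℝ) 1)
    (f : (V → ℝ) → ℝ)
    (hf : ∀ a : V → ℝ,
      f a = ∑ j, ((1 - (1 - diagonal a) * P)⁻¹ *ᵥ (diagonal a *ᵥ s)) j)
    (α β : V → ℝ)
    (hα : ∀ j, α j ∈ Set.Ioo (0 : ℝ) 1) (hβ : ∀ j, β j ∈ Set.Ioo (0 : ℝ) 1)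
    (i k : V) (hik : i ≠ k)
    (hΔ : {j : V | α j ≠ β j} = {i, k})
    (g : ℝ → ℝ → ℝ)
    (hg : ∀ x y : ℝ, g x y = f (Function.update (Function.update α i x) k y))
    (hmin : min (g (α i) (α k)) (g (β i) (β k)) <
            min (g (α i) (β k)) (g (β i) (α k))) :
    min (g (α i) (β k)) (g (β i) (α k)) <
      max (g (α i) (α k)) (g (β i) (β k)) := by
  have hi : α i ≠ β i := by
    have : i ∈ {j : V | α j ≠ β j} := by rw [hΔ]; simp
    exact this
  have hmem : ∀ x y : ℝ, x ∈ Set.Ioo (0 : ℝ) 1 → y ∈ Set.Ioo (0 : ℝ) 1 →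
      ∀ j, Function.update (Function.update α i x) k y j ∈ Set.Ioo (0 : ℝ) 1 := by
    intro x y hx hy j
    simp only [Function.update_apply]
    split_ifs
    exacts [hy, hx, hα j]
  have core : ∀ a b c d : ℝ, a ∈ Set.Ioo (0 : ℝ) 1 → b ∈ Set.Ioo (0 : ℝ) 1 →
      c ∈ Set.Ioo (0 : ℝ) 1 → d ∈ Set.Ioo (0 : ℝ) 1 → a < b →
      g a c ≤ g b c → g b d ≤ g a d → g b d ≤ g b c → g b c ≤ g a c ∧ g a d ≤ g b d := by
    intro a b c d ha hb hc hd hab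
    simp only [hg, hf]
    have hupd : ∀ x y : ℝ, Function.update (Function.update α i x) k y i = x := by
      intro x y
      simp [Function.update_apply, hik]
    refine sw_core P hP0 hP1 s _ _ _ _ _ _ _ _ (hmem a c ha hc) (hmem b c hb hc)
      (hmem a d ha hd) i k ?_ ?_ ?_ ?_ ?_
      (sw_exists P hP0 hP1 s _ (hmem a c ha hc)) (sw_exists P hP0 hP1 s _ (hmem b c hb hc))
      (sw_exists P hP0 hP1 s _ (hmem a d ha hd)) (sw_exists P hP0 hP1 s _ (hmem b d hb hd))
    · intro j hj; simp [Function.update_apply, hj]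
    · intro j hj; simp [Function.update_apply, hj]
    · intro j hj; simp [Function.update_apply, hj]
    · rw [hupd, hupd]; exact hab
    · rw [hupd, hupd]; exact hab
  by_contra hcon
  obtain ⟨m1, m2⟩ := max_le_iff.1 (not_lt.1 hcon)
  obtain ⟨n1, n2⟩ := le_min_iff.1 m1
  obtain ⟨n3, n4⟩ := le_min_iff.1 m2
  have fin : g (β i) (α k) ≤ g (α i) (α k) ∧ g (α i) (β k) ≤ g (β i) (β k) := by
    rcases lt_or_gt_of_ne hi with h | h
    · exact core _ _ _ _ (hα i) (hβ i) (hα k) (hβ k) h n2 n3 n4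
    · exact (core _ _ _ _ (hβ i) (hα i) (hβ k) (hα k) h n3 n2 n1).symm
  refine absurd hmin (not_lt.2 (le_min ?_ ?_))
  · exact (min_le_right _ _).trans fin.1
  · exact (min_le_left _ _).trans fin.2
end

section
/- (Descending Coordinate) Let P be an irreducible row-stochastic matrix on a set V with |V| ≥ 3, s ∈ [0,1]^V, and let f(α) = 1ᵀ [I − (I − A)P]^{−1} A s. Suppose α, β ∈ (0,1)^V satisfy f(α) > f(β). Then there exists a coordinate i ∈ Δ(α, β) such that the vector γ obtained from α by replacing its i-th coordinate by β_i (so Δ(α, γ) = {i} and Δ(γ, β) = Δ(α, β) \ {i}) satisfies f(α) > f(γ). -/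
open Matrix

lemma maxPrinciple {V : Type*} [Fintype V]
    (P : Matrix V V ℝ) (hP0 : ∀ i j, 0 ≤ P i j) (hP1 : ∀ i, ∑ j, P i j = 1)
    (a : V → ℝ) (ha : ∀ j, a j ∈ Set.Ioo (0 : ℝ) 1) (w : V → ℝ)
    (h : ∀ i, (1 - a i) * (P *ᵥ w) i ≤ w i) : ∀ i, 0 ≤ w i := by
  intro k
  obtain ⟨i, -, hi⟩ := Finset.exists_min_image Finset.univ w ⟨k, Finset.mem_univ k⟩
  have h1 : w i ≤ (P *ᵥ w) i := by
    calc w i = ∑ j, P i j * w i := by rw [← Finset.sum_mul, hP1, one_mul]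
      _ ≤ ∑ j, P i j * w j := Finset.sum_le_sum fun j hj =>
          mul_le_mul_of_nonneg_left (hi j hj) (hP0 i j)
      _ = _ := rfl
  have h2 := h i
  have h3 := (ha i).1
  have h4 := (ha i).2
  have h5 := mul_le_mul_of_nonneg_left h1 (by linarith : 0 ≤ 1 - a i)
  have h6 : 0 ≤ w i := by
    by_contra hc
    push Not at hc
    nlinarith
  exact h6.trans (hi k (Finset.mem_univ k))

lemma mulVec_row {V : Type*} [Fintype V] [DecidableEq V]
    (P : Matrix V V ℝ) (a w : V → ℝ) (i : V) :
    ((1 - (1 - diagonal a) * P) *ᵥ w) i = w i - (1 - a i) * (P *ᵥ w) i := by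
  rw [sub_mulVec, one_mulVec, ← mulVec_mulVec, sub_mulVec, one_mulVec, Pi.sub_apply, Pi.sub_apply,
    mulVec_diagonal]
  ring

lemma equil {V : Type*} [Fintype V] [DecidableEq V]
    (P : Matrix V V ℝ) (hP0 : ∀ i j, 0 ≤ P i j) (hP1 : ∀ i, ∑ j, P i j = 1) (s : V → ℝ)
    (a : V → ℝ) (ha : ∀ j, a j ∈ Set.Ioo (0 : ℝ) 1) :
    ∀ i, ((1 - (1 - diagonal a) * P)⁻¹ *ᵥ (diagonal a *ᵥ s)) i
      = (1 - a i) * (P *ᵥ ((1 - (1 - diagonal a) * P)⁻¹ *ᵥ (diagonal a *ᵥ s))) i + a i * s i := by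
  intro i
  have hdet : (1 - (1 - diagonal a) * P).det ≠ 0 := by
    intro h0
    obtain ⟨v, hv, hv0⟩ := exists_mulVec_eq_zero_iff.mpr h0
    apply hv
    have hr : ∀ i, v i - (1 - a i) * (P *ᵥ v) i = 0 := fun i => by
      rw [← mulVec_row, hv0]; rfl
    have p1 := maxPrinciple P hP0 hP1 a ha v (fun i => by linarith [hr i])
    have p2 := maxPrinciple P hP0 hP1 a ha (-v) (fun i => by
      rw [mulVec_neg, Pi.neg_apply, Pi.neg_apply]; linarith [hr i])
    funext i
    have := p2 i
    rw [Pi.neg_apply] at this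
    exact le_antisymm (neg_nonneg.mp this) (p1 i)
  have h := mulVec_row P a ((1 - (1 - diagonal a) * P)⁻¹ *ᵥ (diagonal a *ᵥ s)) i
  rw [mulVec_mulVec _ (1 - (1 - diagonal a) * P), mul_nonsing_inv _ (isUnit_iff_ne_zero.mpr hdet),
    one_mulVec, mulVec_diagonal] at h
  linarith

/-- Lemma (Descending Coordinate): if `f(α) > f(β)`, then there is a coordinate
`i ∈ Δ(α, β)` such that switching coordinate `i` of `α` to that of `β` strictly
decreases `f`; the resulting vector `γ = Function.update α i (β i)` satisfies
`Δ(α, γ) = {i}` and `Δ(γ, β) = Δ(α, β) \ {i}`. -/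
theorem stmt12 {V : Type*} [Fintype V] [DecidableEq V]
    (hcard : 3 ≤ Fintype.card V)
    (P : Matrix V V ℝ)
    (hP0 : ∀ i j, 0 ≤ P i j) (hP1 : ∀ i, ∑ j, P i j = 1)
    (hPirr : ∀ i j, ∃ t : ℕ, 1 ≤ t ∧ 0 < (P ^ t) i j)
    (s : V → ℝ) (hs : ∀ i, s i ∈ Set.Icc (0 : ℝ) 1)
    (f : (V → ℝ) → ℝ)
    (hf : ∀ a : V → ℝ,
      f a = ∑ j, ((1 - (1 - diagonal a) * P)⁻¹ *ᵥ (diagonal a *ᵥ s)) j)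
    (α β : V → ℝ)
    (hα : ∀ j, α j ∈ Set.Ioo (0 : ℝ) 1) (hβ : ∀ j, β j ∈ Set.Ioo (0 : ℝ) 1)
    (hfαβ : f α > f β) :
    ∃ i : V, α i ≠ β i ∧
      {j : V | α j ≠ (Function.update α i (β i)) j} = {i} ∧
      {j : V | (Function.update α i (β i)) j ≠ β j} = {j : V | α j ≠ β j} \ {i} ∧
      f α > f (Function.update α i (β i)) := by
  have hu : ∀ i j, Function.update α i (β i) j ∈ Set.Ioo (0 : ℝ) 1 := by
    intro i j
    by_cases h : j = i
    · subst h; simpa using hβ j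
    · simpa [h] using hα j
  have eα := equil P hP0 hP1 s α hα
  have eβ := equil P hP0 hP1 s β hβ
  have eγ := fun i => equil P hP0 hP1 s (Function.update α i (β i)) (hu i)
  rw [hf α, hf β] at hfαβ
  simp only [hf]
  generalize ((1 - (1 - diagonal α) * P)⁻¹ *ᵥ (diagonal α *ᵥ s)) = z at *
  generalize ((1 - (1 - diagonal β) * P)⁻¹ *ᵥ (diagonal β *ᵥ s)) = y at *
  have hex : ∃ i, (β i - α i) * (s i - (P *ᵥ z) i) < 0 := by
    by_contra hc
    push Not at hc
    have hw := maxPrinciple P hP0 hP1 β hβ (y - z) (fun i => by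
      rw [mulVec_sub, Pi.sub_apply, Pi.sub_apply]
      linarith [hc i, eα i, eβ i])
    have : ∑ j, z j ≤ ∑ j, y j := Finset.sum_le_sum fun j _ => by
      have := hw j
      rw [Pi.sub_apply] at this
      linarith
    linarith
  obtain ⟨i, hi⟩ := hex
  have hne : α i ≠ β i := by
    intro h
    rw [h] at hi
    simp at hi
  refine ⟨i, hne, ?_, ?_, ?_⟩
  · ext j
    by_cases h : j = i
    · subst h; simpa using hne
    · simp [h]
  · ext j
    by_cases h : j = i
    · subst h; simp
    · simp [h]
  · have eg := eγ i
    generalize ((1 - (1 - diagonal (Function.update α i (β i))) * P)⁻¹ *ᵥ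
      (diagonal (Function.update α i (β i)) *ᵥ s)) = x at *
    have hw := maxPrinciple P hP0 hP1 _ (hu i) (z - x) (fun j => by
      rw [mulVec_sub, Pi.sub_apply, Pi.sub_apply]
      have h1 := eg j
      have h2 := eα j
      by_cases h : j = i
      · subst h
        rw [Function.update_self] at *
        linarith
      · rw [Function.update_of_ne h] at *
        linarith)
    have hle : ∀ j, x j ≤ z j := fun j => by
      have := hw j
      rw [Pi.sub_apply] at this
      linarith
    refine Finset.sum_lt_sum (fun j _ => hle j) ⟨i, Finset.mem_univ i, ?_⟩
    have h1 := eg i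
    have h2 := eα i
    rw [Function.update_self] at h1
    have h3 : (P *ᵥ x) i ≤ (P *ᵥ z) i :=
      Finset.sum_le_sum fun j _ => mul_le_mul_of_nonneg_left (hle j) (hP0 i j)
    have h4 := mul_le_mul_of_nonneg_left h3 (by linarith [(hβ i).2] : 0 ≤ 1 - β i)
    linarith
end

section
/- (Monotonicity under a flip) Let P be an irreducible row-stochastic matrix, s ∈ [0,1]^V, and z(α) = [I − (I − A)P]^{−1} A s. Suppose α, α' ∈ (0,1)^V differ only in coordinate i, with α'_i ≤ α_i, and suppose s_i − z_i(α) > 0. Then for every k ∈ V, z_k(α') ≤ z_k(α); in particular, s_k − z_k(α') ≥ s_k − z_k(α) for every k ∈ V, so any coordinate k with s_k − z_k(α) > 0 still satisfies s_k − z_k(α') > 0 after the update. -/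
open Matrix

lemma flip_max_principle {V : Type*} [Fintype V] [Nonempty V]
    (P : Matrix V V ℝ)
    (hP0 : ∀ i j, 0 ≤ P i j) (hP1 : ∀ i, ∑ j, P i j = 1)
    (a : V → ℝ) (ha : ∀ j, a j ∈ Set.Ioo (0 : ℝ) 1)
    (w : V → ℝ) (hw : ∀ k, 0 ≤ w k - (1 - a k) * (P *ᵥ w) k) : ∀ k, 0 ≤ w k := by
  obtain ⟨m, hm⟩ := Finite.exists_min w
  intro k
  refine le_trans ?_ (hm k)
  by_contra hneg
  push Not at hneg
  have h1 : w m ≤ (P *ᵥ w) m := by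
    calc w m = ∑ j, P m j * w m := by rw [← Finset.sum_mul, hP1, one_mul]
      _ ≤ ∑ j, P m j * w j :=
        Finset.sum_le_sum fun j _ => mul_le_mul_of_nonneg_left (hm j) (hP0 m j)
      _ = (P *ᵥ w) m := rfl
  have h2 := hw m
  obtain ⟨h3, h4⟩ := ha m
  nlinarith [mul_le_mul_of_nonneg_left h1 (sub_nonneg.2 h4.le), mul_pos h3 (neg_pos.2 hneg)]

lemma flip_mulVec {V : Type*} [Fintype V] [DecidableEq V]
    (P : Matrix V V ℝ) (a w : V → ℝ) (k : V) :
    ((1 - (1 - diagonal a) * P) *ᵥ w) k = w k - (1 - a k) * (P *ᵥ w) k := by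
  rw [sub_mulVec, one_mulVec, ← mulVec_mulVec, sub_mulVec, one_mulVec]
  simp only [Pi.sub_apply, mulVec_diagonal]
  ring

lemma flip_equilibrium {V : Type*} [Fintype V] [DecidableEq V] [Nonempty V]
    (P : Matrix V V ℝ)
    (hP0 : ∀ i j, 0 ≤ P i j) (hP1 : ∀ i, ∑ j, P i j = 1)
    (a : V → ℝ) (ha : ∀ j, a j ∈ Set.Ioo (0 : ℝ) 1) (s z : V → ℝ)
    (hz : z = (1 - (1 - diagonal a) * P)⁻¹ *ᵥ (diagonal a *ᵥ s)) (k : V) :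
    z k - (1 - a k) * (P *ᵥ z) k = a k * s k := by
  have hinj : Function.Injective (1 - (1 - diagonal a) * P).mulVec := by
    intro x y hxy
    have key : ∀ u v : V → ℝ, (1 - (1 - diagonal a) * P) *ᵥ u =
        (1 - (1 - diagonal a) * P) *ᵥ v → ∀ k, 0 ≤ (u - v) k := by
      intro u v huv
      apply flip_max_principle P hP0 hP1 a ha
      intro k
      rw [← flip_mulVec, mulVec_sub, huv, sub_self]
      simp
    funext j
    have h1 := key x y hxy j
    have h2 := key y x hxy.symm j
    simp only [Pi.sub_apply] at h1 h2
    linarith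
  have hu : IsUnit (1 - (1 - diagonal a) * P) := mulVec_injective_iff_isUnit.1 hinj
  rw [← flip_mulVec, hz, mulVec_mulVec,
    mul_nonsing_inv _ ((isUnit_iff_isUnit_det _).1 hu), one_mulVec, mulVec_diagonal]

/-- Monotonicity under a flip: if `α'` agrees with `α` except at coordinate `i`, where
`α'_i ≤ α_i`, and `s_i − z_i(α) > 0`, then every equilibrium coordinate weakly decreases:
`z_k(α') ≤ z_k(α)` for all `k`; in particular `s_k − z_k(α') ≥ s_k − z_k(α)` for all `k`,
so positive gaps stay positive. -/
theorem stmt14 {V : Type*} [Fintype V] [DecidableEq V] [Nonempty V]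
    (P : Matrix V V ℝ)
    (hP0 : ∀ i j, 0 ≤ P i j) (hP1 : ∀ i, ∑ j, P i j = 1)
    (hPirr : ∀ i j, ∃ t : ℕ, 1 ≤ t ∧ 0 < (P ^ t) i j)
    (s : V → ℝ) (hs : ∀ i, s i ∈ Set.Icc (0 : ℝ) 1)
    (z : (V → ℝ) → V → ℝ)
    (hz : ∀ a : V → ℝ, z a = (1 - (1 - diagonal a) * P)⁻¹ *ᵥ (diagonal a *ᵥ s))
    (α α' : V → ℝ)
    (hα : ∀ j, α j ∈ Set.Ioo (0 : ℝ) 1) (hα' : ∀ j, α' j ∈ Set.Ioo (0 : ℝ) 1)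
    (i : V) (hagree : ∀ j, j ≠ i → α' j = α j) (hle : α' i ≤ α i)
    (hpos : 0 < s i - z α i) :
    (∀ k, z α' k ≤ z α k) ∧
    (∀ k, s k - z α k ≤ s k - z α' k) ∧
    (∀ k, 0 < s k - z α k → 0 < s k - z α' k) := by
  have e1 := flip_equilibrium P hP0 hP1 α hα s _ (hz α)
  have e2 := flip_equilibrium P hP0 hP1 α' hα' s _ (hz α')
  have main : ∀ k, 0 ≤ (z α - z α') k := by
    apply flip_max_principle P hP0 hP1 α' hα'
    intro k
    have h1 := e1 k
    have h2 := e2 k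
    rw [mulVec_sub]
    simp only [Pi.sub_apply]
    by_cases hk : k = i
    · subst hk
      obtain ⟨h3, h4⟩ := hα k
      have h5 : 0 < (1 - α k) * (s k - (P *ᵥ z α) k) := by linarith
      have h6 : 0 < s k - (P *ᵥ z α) k := pos_of_mul_pos_right h5 (by linarith)
      nlinarith [mul_nonneg (sub_nonneg.2 hle) h6.le]
    · rw [hagree k hk] at h2 ⊢
      linarith
  have main' : ∀ k, z α' k ≤ z α k := fun k => sub_nonneg.1 (main k)
  exact ⟨main', fun k => by linarith [main' k], fun k hk => by linarith [main' k]⟩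
end
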